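/- Under Assumptions (A1)–(A3), for every r > 0 and every finite rooted graph (H,h), define the empirical Euclidean-neighbourhood frequency C_{r,n}(H,h) := (1/n) Σ_{i=1}^n 1{ F^{𝔾_n}_i(r) is rooted-isomorphic to (H,h) }. Then the variance of C_{r,n}(H,h) converges to 0 as n → ∞. -/

import Mathlib

open MeasureTheory ProbabilityTheory Filter Topology
open scoped ENNReal NNReal

noncomputable section

/-- Euclidean space `ℝ^d`. -/
abbrev Euc (d : ℕ) : Type := EuclideanSpace ℝ (Fin d)

open Classical in
/-- Real-valued indicator of a proposition. -/
noncomputable def indic (p : Prop) : ℝ := if p then 1 else 0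

/-- The box `I_n = [-n^{1/d}/2, n^{1/d}/2]^d`. -/
def boxIn (d n : ℕ) : Set (Euc d) :=
  {x | ∀ i, |x i| ≤ ((n : ℝ) ^ ((1 : ℝ) / d)) / 2}

/-- Uniform probability measure on the box `I_n` (which has Lebesgue measure `n`). -/
noncomputable def unifBox (d n : ℕ) : Measure (Euc d) :=
  (n : ℝ≥0∞)⁻¹ • (volume.restrict (boxIn d n))

/-- Uniform probability measure on `[0,1]`. -/
noncomputable def unif01 : Measure ℝ := volume.restrict (Set.Icc 0 1)

/-- Uniform probability measure on the open Euclidean ball of radius `r` about the origin. -/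
noncomputable def unifBall (d : ℕ) (r : ℝ) : Measure (Euc d) :=
  (volume (Metric.ball (0 : Euc d) r))⁻¹ • (volume.restrict (Metric.ball (0 : Euc d) r))

/-- The sequence of finite spatial inhomogeneous random graphs (SIRGs), on a probability
space `(Ω, P)`: for each `n`, vertex locations `Y n` are i.i.d. uniform on the box `I_n`
(these are the blown-up locations `Y_i = n^{1/d} X_i` with `X_i` i.i.d. uniform on the unit
cube), `Wt n` is a random weight vector, `U n` is an array whose entries for `i < j` are
i.i.d. Uniform[0,1] variables, the three being mutually independent; `κn n` is a connection
function with values in `[0,1]` (for positive first argument), measurable and symmetric in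
its last two arguments; `R n` is a pair of independent uniformly chosen vertices,
independent of everything else. -/
structure SIRGModel (d : ℕ) (Ω : Type) [MeasurableSpace Ω] where
  P : Measure Ω
  probP : IsProbabilityMeasure P
  Y : (n : ℕ) → Fin n → Ω → Euc d
  Wt : (n : ℕ) → Fin n → Ω → ℝ
  U : (n : ℕ) → Fin n → Fin n → Ω → ℝ
  R : (n : ℕ) → 0 < n → Fin 2 → Ω → Fin n
  κn : ℕ → ℝ → ℝ → ℝ → ℝ
  Y_meas : ∀ n i, Measurable (Y n i)
  Wt_meas : ∀ n i, Measurable (Wt n i)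
  U_meas : ∀ n i j, Measurable (U n i j)
  R_meas : ∀ n hn k, Measurable (R n hn k)
  κn_meas : ∀ n, Measurable (fun p : ℝ × ℝ × ℝ => κn n p.1 p.2.1 p.2.2)
  κn_nonneg : ∀ n t x y, 0 < t → 0 ≤ κn n t x y
  κn_le_one : ∀ n t x y, 0 < t → κn n t x y ≤ 1
  κn_symm : ∀ n t x y, κn n t x y = κn n t y x
  joint_law : ∀ n : ℕ,
      Measure.map (fun ω =>
        ((fun i => Y n i ω), (fun i => Wt n i ω),
          (fun p : {p : Fin n × Fin n // p.1 < p.2} => U n p.1.1 p.1.2 ω))) P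
        = (Measure.pi fun _ : Fin n => unifBox d n).prod
            ((Measure.map (fun ω i => Wt n i ω) P).prod
              (Measure.pi fun _ : {p : Fin n × Fin n // p.1 < p.2} => unif01))
  R_unif : ∀ n hn (i j : Fin n),
      P {ω | R n hn 0 ω = i ∧ R n hn 1 ω = j} = ((n : ℝ≥0∞) * n)⁻¹
  R_indep : ∀ n hn,
      IndepFun (fun ω => (R n hn 0 ω, R n hn 1 ω))
        (fun ω => ((fun i => Y n i ω), (fun i => Wt n i ω), (fun i j => U n i j ω))) P

variable {d : ℕ} {Ω : Type} [MeasurableSpace Ω]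

instance (M : SIRGModel d Ω) : IsProbabilityMeasure M.P := M.probP

/-- The random graph `𝔾_n`: for `i < j`, the edge `{i,j}` is present iff
`U_{ij} ≤ κ_n(‖Y_i - Y_j‖, W_i, W_j)`. -/
def SIRGModel.graph (M : SIRGModel d Ω) (n : ℕ) (ω : Ω) : SimpleGraph (Fin n) :=
  SimpleGraph.fromRel (fun i j =>
    i < j ∧ M.U n i j ω ≤
      M.κn n (dist (M.Y n i ω) (M.Y n j ω)) (M.Wt n i ω) (M.Wt n j ω))

open Classical in
/-- Degree of a vertex in a finite simple graph. -/
noncomputable def degOf {V : Type*} [Fintype V] (G : SimpleGraph V) (v : V) : ℕ :=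
  (Finset.univ.filter fun u => G.Adj v u).card

/-- Rooted isomorphism of rooted graphs. -/
def RootedIso {V₁ : Type*} {V₂ : Type*} (G₁ : SimpleGraph V₁) (r₁ : V₁)
    (G₂ : SimpleGraph V₂) (r₂ : V₂) : Prop :=
  ∃ φ : G₁ ≃g G₂, φ r₁ = r₂

/-- The (vertex set of the) ball of radius `K` around `o` in the graph `G`:
all vertices reachable from `o` within graph distance `K`. -/
def graphBall {V : Type*} (G : SimpleGraph V) (o : V) (K : ℕ) : Set V :=
  {v | G.Reachable o v ∧ G.dist o v ≤ K}

/-- `ballIso G o K H h`: the subgraph of `G` induced by the `K`-ball around `o`, rooted at `o`,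
is rooted-isomorphic to `(H, h)`. -/
def ballIso {V : Type*} (G : SimpleGraph V) (o : V) (K : ℕ)
    {V' : Type*} (H : SimpleGraph V') (h : V') : Prop :=
  ∃ ho : o ∈ graphBall G o K, RootedIso (G.induce (graphBall G o K)) ⟨o, ho⟩ H h

/-- The set of vertices whose location lies within Euclidean distance `r` of the location
of vertex `i`. -/
def SIRGModel.euclSet (M : SIRGModel d Ω) (n : ℕ) (ω : Ω) (i : Fin n) (r : ℝ) :
    Set (Fin n) :=
  {j | dist (M.Y n j ω) (M.Y n i ω) < r}

/-- The Euclidean graph neighbourhood `F^{𝔾_n}_i(r)`: the subgraph of `𝔾_n` induced by the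
vertices whose location is within distance `r` of the location of `i`. -/
def SIRGModel.euclNbhd (M : SIRGModel d Ω) (n : ℕ) (ω : Ω) (i : Fin n) (r : ℝ) :=
  (M.graph n ω).induce (M.euclSet n ω i r)

/-- `F^{𝔾_n}_i(r)`, rooted at `i`, is rooted-isomorphic to `(H, h)`. -/
def SIRGModel.euclNbhdIso (M : SIRGModel d Ω) (n : ℕ) (ω : Ω) (i : Fin n) (r : ℝ)
    {V : Type*} (H : SimpleGraph V) (h : V) : Prop :=
  ∃ hi : i ∈ M.euclSet n ω i r, RootedIso (M.euclNbhd n ω i r) ⟨i, hi⟩ H h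

/-- The set of vertices in the `K`-ball around `i` of the Euclidean neighbourhood graph
`F^{𝔾_n}_i(r)`, viewed as a subset of the vertex set of `𝔾_n`. -/
def SIRGModel.spatialBall (M : SIRGModel d Ω) (n : ℕ) (ω : Ω) (i : Fin n) (r : ℝ)
    (K : ℕ) : Set (Fin n) :=
  {v | ∃ (hi : i ∈ M.euclSet n ω i r) (hv : v ∈ M.euclSet n ω i r),
      (⟨v, hv⟩ : M.euclSet n ω i r) ∈ graphBall (M.euclNbhd n ω i r) ⟨i, hi⟩ K}

/-- Empirical frequency of the rooted graph `(H,h)` among the Euclidean `r`-neighbourhoods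
`F^{𝔾_n}_i(r)`, `i ∈ [n]`. -/
noncomputable def SIRGModel.empNbhdFreq (M : SIRGModel d Ω) (n : ℕ) (r : ℝ)
    {V : Type*} (H : SimpleGraph V) (h : V) (ω : Ω) : ℝ :=
  (∑ i : Fin n, indic (M.euclNbhdIso n ω i r H h)) / n

/-- Empirical frequency of the rooted graph `(H,h)` among the rooted `K`-balls of `𝔾_n`. -/
noncomputable def SIRGModel.empBallFreq (M : SIRGModel d Ω) (n K : ℕ)
    {V : Type*} (H : SimpleGraph V) (h : V) (ω : Ω) : ℝ :=
  (∑ i : Fin n, indic (ballIso (M.graph n ω) i K H h)) / n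

/-- Prepend the origin to a tuple of points. -/
def withZero {d l : ℕ} (z : Fin l → Euc d) : Fin (l + 1) → Euc d :=
  Fin.cases 0 z

/-- The limiting graph on `l+1` vertices built from locations `0, z 0, …, z (l-1)`, weights `w`
and uniform variables `u`, with connection function `κ`. -/
def limitGraph (d : ℕ) (κ : ℝ → ℝ → ℝ → ℝ) (l : ℕ) (z : Fin l → Euc d)
    (w : Fin (l + 1) → ℝ) (u : Fin (l + 1) → Fin (l + 1) → ℝ) : SimpleGraph (Fin (l + 1)) :=
  SimpleGraph.fromRel (fun i j =>
    i < j ∧ u i j ≤ κ (dist (withZero z i) (withZero z j)) (w i) (w j))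

/-- Poisson probability mass function with mean `lam`. -/
noncomputable def poissonWeight (lam : ℝ≥0∞) (k : ℕ) : ℝ≥0∞ :=
  ENNReal.ofReal (Real.exp (-(lam.toReal)) * lam.toReal ^ k / (Nat.factorial k))

/-- The probability that the Poissonized limiting Euclidean `r`-neighbourhood `F_r`
(rooted at the vertex `0` located at the origin) is rooted-isomorphic to `(H,h)`:
the number `N` of non-root vertices is Poisson with mean `λ_d(B_r)`; given `N = l`, the
non-root locations are i.i.d. uniform on `B_r`, the `l+1` weights are i.i.d. with law `μW`,
and, given everything, edges are present independently with probabilities given by `κ`. -/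
noncomputable def limitNbhdProb (d : ℕ) (κ : ℝ → ℝ → ℝ → ℝ) (μW : Measure ℝ) (r : ℝ)
    {V : Type*} (H : SimpleGraph V) (h : V) : ℝ≥0∞ :=
  ∑' l : ℕ,
    poissonWeight (volume (Metric.ball (0 : Euc d) r)) l *
      ((Measure.pi fun _ : Fin l => unifBall d r).prod
          ((Measure.pi fun _ : Fin (l + 1) => μW).prod
            (Measure.pi fun _ : Fin (l + 1) => Measure.pi fun _ : Fin (l + 1) => unif01)))
        {zwu : (Fin l → Euc d) × (Fin (l + 1) → ℝ) × (Fin (l + 1) → Fin (l + 1) → ℝ) |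
          RootedIso (limitGraph d κ l zwu.1 zwu.2.1 zwu.2.2) 0 H h}

/-- The path expectation
`E[∏_{i=1}^{j} κ_n(‖x_i − x_{i-1}‖, W^{(n)}_{V_{i-1}}, W^{(n)}_{V_i})]`, where
`V_0, …, V_j` are i.i.d. uniform indices on `[n]`, independent of the weights `W^{(n)}`. -/
noncomputable def SIRGModel.pathExp (M : SIRGModel d Ω) (n j : ℕ)
    (x : Fin (j + 1) → Euc d) : ℝ :=
  ∫ ω, (∑ v : Fin (j + 1) → Fin n,
      ∏ i : Fin j,
        M.κn n (dist (x i.succ) (x i.castSucc)) (M.Wt n (v i.castSucc) ω)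
          (M.Wt n (v i.succ) ω)) / (n : ℝ) ^ (j + 1) ∂M.P

/-- `𝕎_j(x_0, …, x_j) = E[∏_{i=1}^{j} κ(‖x_i − x_{i-1}‖, W^{(i-1)}, W^{(i)})]` with
`W^{(0)}, …, W^{(j)}` i.i.d. with law `μW`. -/
noncomputable def Wfun (d : ℕ) (κ : ℝ → ℝ → ℝ → ℝ) (μW : Measure ℝ) (j : ℕ)
    (x : Fin (j + 1) → Euc d) : ℝ :=
  ∫ w : Fin (j + 1) → ℝ,
    ∏ i : Fin j, κ (dist (x i.succ) (x i.castSucc)) (w i.castSucc) (w i.succ)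
    ∂(Measure.pi fun _ : Fin (j + 1) => μW)

/-- The product of indicators
`∏_{i=1}^{j-1} 1{‖x_i − x_{i-1}‖ < a^{m^i}} · 1{‖x_j − x_{j-1}‖ > a^{m^j}}`. -/
noncomputable def pathIndic {d : ℕ} (j : ℕ) (a m : ℝ) (x : Fin (j + 1) → Euc d) : ℝ≥0∞ :=
  ∏ i : Fin j,
    if i.val + 1 < j then
      (if dist (x i.succ) (x i.castSucc) < a ^ (m ^ (i.val + 1)) then 1 else 0)
    else
      (if a ^ (m ^ j) < dist (x i.succ) (x i.castSucc) then 1 else 0)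

/-- The indicator of `z_k ∈ B(a^{m^k})` for `1 ≤ k ≤ j-1` and `z_j ∉ B(a^{m^j})`
(with `z` indexed by `Fin j`, so `z i` stands for `z_{i+1}`). -/
noncomputable def shellIndic {d : ℕ} (j : ℕ) (a m : ℝ) (z : Fin j → Euc d) : ℝ≥0∞ :=
  ∏ i : Fin j,
    if i.val + 1 < j then
      (if ‖z i‖ < a ^ (m ^ (i.val + 1)) then 1 else 0)
    else
      (if a ^ (m ^ j) ≤ ‖z i‖ then 1 else 0)

/-- The expectation `E[κ_n(t, W^{(n)}_{V_1}, W^{(n)}_{V_2})]`, where `V_1, V_2` are i.i.d.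
uniform indices on `[n]`, independent of the weights. -/
noncomputable def SIRGModel.expKn (M : SIRGModel d Ω) (n : ℕ) (t : ℝ) : ℝ :=
  ∫ ω, (∑ v : Fin n × Fin n, M.κn n t (M.Wt n v.1 ω) (M.Wt n v.2 ω)) / (n : ℝ) ^ 2 ∂M.P

/-- The radius `r(a, m, K) = a^m + a^{m^2} + ⋯ + a^{m^K}`. -/
noncomputable def rr (a m : ℝ) (K : ℕ) : ℝ :=
  ∑ k ∈ Finset.range K, a ^ (m ^ (k + 1))

/-- Assumptions (A1)–(A2): convergence in probability of the empirical weight distribution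
to the law `μW` of the limiting weight (at every continuity point of its cdf), and
convergence of the connection functions `κn` to a limiting connection function `κ`. -/
structure SIRGWeakAssumptions {d : ℕ} {Ω : Type} [MeasurableSpace Ω] (M : SIRGModel d Ω) where
  μW : Measure ℝ
  probμW : IsProbabilityMeasure μW
  weights_conv : ∀ x : ℝ, μW {x} = 0 →
    TendstoInMeasure M.P
      (fun n ω => (∑ i : Fin n, indic (M.Wt n i ω ≤ x)) / n) atTop
      (fun _ => (μW (Set.Iic x)).toReal)
  κ : ℝ → ℝ → ℝ → ℝ
  κ_meas : Measurable fun p : ℝ × ℝ × ℝ => κ p.1 p.2.1 p.2.2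
  κ_nonneg : ∀ t x y, 0 < t → 0 ≤ κ t x y
  κ_le_one : ∀ t x y, 0 < t → κ t x y ≤ 1
  κ_symm : ∀ t x y, κ t x y = κ t y x
  κ_conv : ∀ (x y : ℝ) (xs ys : ℕ → ℝ),
      Tendsto xs atTop (𝓝 x) → Tendsto ys atTop (𝓝 y) →
      ∀ᵐ t ∂(volume : Measure ℝ), 0 < t →
        Tendsto (fun n => M.κn n t (xs n) (ys n)) atTop (𝓝 (κ t x y))

/-- Assumptions (A1)–(A3): additionally, the polynomial tail bound
`E[κ(t, W^{(1)}, W^{(2)})] ≤ t^{-α}` with `α > d`, for all `t > t₀`. -/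
structure SIRGAssumptions {d : ℕ} {Ω : Type} [MeasurableSpace Ω] (M : SIRGModel d Ω)
    extends SIRGWeakAssumptions M where
  t₀ : ℝ
  α : ℝ
  t₀_pos : 0 < t₀
  α_gt_dim : (d : ℝ) < α
  κ_tail : ∀ t : ℝ, t₀ < t →
      ∫ p : ℝ × ℝ, κ t p.1 p.2 ∂(μW.prod μW) ≤ t ^ (-α)


lemma bd_integrable {α : Type*} [MeasurableSpace α] {μ : Measure α} [IsFiniteMeasure μ]
    {f : α → ℝ} (hf : Measurable f) {B : ℝ} (hB : ∀ x, |f x| ≤ B) : Integrable f μ :=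
  Integrable.of_bound hf.aestronglyMeasurable B (Eventually.of_forall hB)

lemma bd_sq_dec {α : Type*} [MeasurableSpace α] {μ : Measure α} [IsProbabilityMeasure μ]
    {f : α → ℝ} (hf : Measurable f) {B : ℝ} (hB : ∀ x, |f x| ≤ B) (a : ℝ) :
    ∫ x, (f x - a) ^ 2 ∂μ = ∫ x, (f x - ∫ z, f z ∂μ) ^ 2 ∂μ + (∫ z, f z ∂μ - a) ^ 2 := by
  set m := ∫ z, f z ∂μ with hm
  have hi : Integrable f μ := bd_integrable hf hB
  have hi2 : Integrable (fun x => (f x - m) ^ 2) μ := by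
    refine bd_integrable (by fun_prop) (B := (B + |m|) ^ 2) fun x => ?_
    rw [abs_pow]
    have := abs_sub (f x) m
    have := hB x
    gcongr
    linarith
  have h1 : ∀ x, (f x - a) ^ 2 = (f x - m) ^ 2 + (2 * (m - a) * f x + (a ^ 2 - m ^ 2)) := by
    intro x; ring
  simp_rw [h1]
  have hi3 : Integrable (fun x => 2 * (m - a) * f x) μ := hi.const_mul _
  have hi4 : Integrable (fun x => 2 * (m - a) * f x + (a ^ 2 - m ^ 2)) μ :=
    hi3.add (integrable_const _)
  rw [integral_add hi2 hi4, integral_add hi3 (integrable_const _), integral_const_mul, ← hm]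
  simp
  ring

lemma osc_var {α : Type*} [MeasurableSpace α] {μ : Measure α} [IsProbabilityMeasure μ]
    {f : α → ℝ} (hf : Measurable f) {B : ℝ} (hB : ∀ x, |f x| ≤ B) (c : ℝ)
    (hc : ∀ x y, |f x - f y| ≤ c) :
    ∫ x, (f x - ∫ z, f z ∂μ) ^ 2 ∂μ ≤ c ^ 2 := by
  have hi : Integrable f μ := bd_integrable hf hB
  have key : ∀ x, |f x - ∫ z, f z ∂μ| ≤ c := by
    intro x
    have : f x - ∫ z, f z ∂μ = ∫ z, (f x - f z) ∂μ := by
      rw [integral_sub (integrable_const _) hi]; simp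
    rw [this]
    have := norm_integral_le_of_norm_le_const (μ := μ) (f := fun z => f x - f z) (C := c)
      (Eventually.of_forall fun z => hc x z)
    simpa using this
  calc ∫ x, (f x - ∫ z, f z ∂μ) ^ 2 ∂μ ≤ ∫ x, c ^ 2 ∂μ := by
        refine integral_mono_of_nonneg (Eventually.of_forall fun x => sq_nonneg _)
          (integrable_const _) (Eventually.of_forall fun x => ?_)
        exact sq_le_sq' (by linarith [abs_le.1 (key x)]) (abs_le.1 (key x)).2
    _ = c ^ 2 := by simp

lemma abs_int_le {α : Type*} [MeasurableSpace α] {μ : Measure α} [IsProbabilityMeasure μ]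
    {f : α → ℝ} {B : ℝ} (hB : ∀ x, |f x| ≤ B) : |∫ x, f x ∂μ| ≤ B := by
  have := norm_integral_le_of_norm_le_const (μ := μ) (f := f) (C := B)
      (Eventually.of_forall fun z => hB z)
  simpa using this

lemma es_prod {α β : Type*} [MeasurableSpace α] [MeasurableSpace β] {μ : Measure α}
    {ν : Measure β} [IsProbabilityMeasure μ] [IsProbabilityMeasure ν]
    {f : α → β → ℝ} (hf : Measurable (Function.uncurry f)) {B : ℝ} (hB : ∀ x y, |f x y| ≤ B)
    (a : ℝ) (v : α → ℝ) (hvi : Integrable v μ)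
    (hv : ∀ x, ∫ y, (f x y - ∫ z, f x z ∂ν) ^ 2 ∂ν ≤ v x) :
    ∫ x, ∫ y, (f x y - a) ^ 2 ∂ν ∂μ ≤ ∫ x, v x ∂μ + ∫ x, (∫ y, f x y ∂ν - a) ^ 2 ∂μ := by
  have hg : Measurable fun x => ∫ y, f x y ∂ν :=
    (hf.stronglyMeasurable.integral_prod_right).measurable
  have hg2 : Integrable (fun x => (∫ y, f x y ∂ν - a) ^ 2) μ := by
    refine bd_integrable (by fun_prop) (B := (B + |a|) ^ 2) fun x => ?_
    rw [abs_pow]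
    have := abs_sub (∫ y, f x y ∂ν) a
    have := abs_int_le (μ := ν) (hB x)
    gcongr
    linarith
  rw [← integral_add hvi hg2]
  refine integral_mono_of_nonneg (Eventually.of_forall fun x => integral_nonneg fun y => sq_nonneg _)
    (hvi.add hg2) (Eventually.of_forall fun x => ?_)
  simp only
  rw [bd_sq_dec (hf.of_uncurry_left) (hB x)]
  have := hv x
  linarith

lemma es_fin {α : Type*} [MeasurableSpace α] {μ : Measure α} [IsProbabilityMeasure μ] :
    ∀ (n : ℕ) (f : (Fin n → α) → ℝ) (_ : Measurable f) (B : ℝ) (_ : ∀ x, |f x| ≤ B)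
      (c : Fin n → ℝ) (_ : ∀ x i a, |f x - f (Function.update x i a)| ≤ c i),
      ∫ x, (f x - ∫ z, f z ∂(Measure.pi fun _ => μ)) ^ 2 ∂(Measure.pi fun _ => μ)
        ≤ ∑ i, c i ^ 2 := by
  intro n
  induction n with
  | zero =>
    intro f hf B hB c hc
    have : ∀ x : Fin 0 → α, f x = f default := fun x => by rw [Subsingleton.elim x default]
    simp_rw [this]
    simp
  | succ n ih =>
    intro f hf B hB c hc
    set m := ∫ z, f z ∂(Measure.pi fun _ : Fin (n + 1) => μ) with hm
    have hmp := (measurePreserving_piFinSuccAbove (fun _ : Fin (n + 1) => μ) 0).symm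
    set e := (MeasurableEquiv.piFinSuccAbove (fun _ : Fin (n + 1) => α) 0).symm with he
    have hev : ∀ p : α × (Fin n → α), e p = Fin.cons p.1 p.2 := by
      intro p
      have : e p = Fin.insertNth 0 p.1 p.2 := rfl
      rw [this, Fin.insertNth_zero]
      rfl
    set F : α → (Fin n → α) → ℝ := fun x y => f (e (x, y)) with hF
    have hFm : Measurable (Function.uncurry F) := hf.comp e.measurable
    have tr : ∀ g : (Fin (n + 1) → α) → ℝ, Measurable g → (∃ B, ∀ x, |g x| ≤ B) →
        ∫ x, g x ∂(Measure.pi fun _ => μ) =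
          ∫ x, ∫ y, g (e (x, y)) ∂(Measure.pi fun _ => μ) ∂μ := by
      rintro g hg ⟨B, hB⟩
      rw [← hmp.integral_comp' (f := e)]
      rw [integral_prod]
      exact bd_integrable (hg.comp e.measurable) fun x => hB _
    have hm2 : m = ∫ x, ∫ y, F x y ∂(Measure.pi fun _ => μ) ∂μ := tr f hf ⟨B, hB⟩
    rw [tr (fun x => (f x - m) ^ 2) (by fun_prop)]
    swap
    · refine ⟨(B + |m|) ^ 2, fun x => ?_⟩
      rw [abs_pow]
      have := abs_sub (f x) m
      have := hB x
      gcongr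
      linarith
    have h1 := es_prod (μ := μ) (ν := Measure.pi fun _ : Fin n => μ) hFm (fun x y => hB _) m
      (fun _ => ∑ i : Fin n, c i.succ ^ 2) (integrable_const _) (by
        intro x
        refine ih (F x) (hFm.of_uncurry_left) B (fun y => hB _) _ ?_
        intro y i a
        have := hc (e (x, y)) i.succ a
        simpa [hF, hev, Fin.cons_update] using this)
    refine h1.trans ?_
    have h2 := osc_var (μ := μ) (f := fun x => ∫ y, F x y ∂(Measure.pi fun _ : Fin n => μ))
      (hFm.stronglyMeasurable.integral_prod_right).measurable
      (fun x => abs_int_le (fun y => hB _)) (c 0) (by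
        intro x x'
        rw [← integral_sub (bd_integrable hFm.of_uncurry_left (fun y => hB _))
          (bd_integrable hFm.of_uncurry_left (fun y => hB _))]
        refine abs_int_le fun y => ?_
        have := hc (e (x, y)) 0 x'
        simpa [hF, hev, Fin.update_cons_zero] using this)
    rw [← hm2] at h2
    rw [Fin.sum_univ_succ]
    simp only [integral_const, probReal_univ, one_smul]
    linarith

lemma es_pi {ι α : Type*} [Fintype ι] [DecidableEq ι] [MeasurableSpace α] {μ : Measure α}
    [IsProbabilityMeasure μ] (f : (ι → α) → ℝ) (hf : Measurable f) (B : ℝ)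
    (hB : ∀ x, |f x| ≤ B)
    (c : ι → ℝ) (hc : ∀ x i a, |f x - f (Function.update x i a)| ≤ c i) :
      ∫ x, (f x - ∫ z, f z ∂(Measure.pi fun _ => μ)) ^ 2 ∂(Measure.pi fun _ => μ)
        ≤ ∑ i, c i ^ 2 := by
  let σ : Fin (Fintype.card ι) ≃ ι := (Fintype.equivFin ι).symm
  have hmp := measurePreserving_piCongrLeft (fun _ : ι => μ) σ
  set e := MeasurableEquiv.piCongrLeft (fun _ : ι => α) σ with he
  have hev : ∀ x i, e x i = x (σ.symm i) := by
    intro x i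
    obtain ⟨j, rfl⟩ := σ.surjective i
    simp [he, MeasurableEquiv.coe_piCongrLeft]
  have h := es_fin (μ := μ) _ (fun x => f (e x)) (hf.comp e.measurable) B (fun x => hB _)
    (fun i => c (σ i)) (by
      intro x i a
      convert hc (e x) (σ i) a using 4
      ext j
      rw [hev]
      by_cases hj : j = σ i
      · subst hj; simp
      · rw [Function.update_of_ne hj, Function.update_of_ne, hev]
        intro h'; exact hj (by rw [← h']; simp))
  rw [hmp.integral_comp' (g := f)] at h
  rw [hmp.integral_comp' (g := fun x => (f x - ∫ z, f z ∂(Measure.pi fun _ => μ)) ^ 2)] at h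
  rwa [σ.sum_comp (fun i => c i ^ 2)] at h

/-- Ordered pairs of vertices. -/
abbrev Prs (n : ℕ) : Type := {p : Fin n × Fin n // p.1 < p.2}

/-- Graph from a relation on ordered pairs. -/
def gphF {n : ℕ} (adj : Prs n → Prop) : SimpleGraph (Fin n) :=
  SimpleGraph.fromRel (fun i j => ∃ h : i < j, adj ⟨(i, j), h⟩)

/-- The neighbourhood of `i` is isomorphic to the target. -/
def nbF {n : ℕ} (near : Fin n → Fin n → Prop) (adj : Prs n → Prop) {V : Type}
    (H : SimpleGraph V) (h : V) (i : Fin n) : Prop :=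
  ∃ hi : i ∈ {j | near j i}, RootedIso ((gphF adj).induce {j | near j i}) ⟨i, hi⟩ H h

/-- Empirical frequency. -/
def Cf {n : ℕ} (near : Fin n → Fin n → Prop) (adj : Prs n → Prop) {V : Type}
    (H : SimpleGraph V) (h : V) : ℝ :=
  (∑ i : Fin n, indic (nbF near adj H h i)) / n

/-- Nearness relation. -/
def nearR {d n : ℕ} (r : ℝ) (y : Fin n → Euc d) (j i : Fin n) : Prop := dist (y j) (y i) < r

/-- Edge relation. -/
def edg {d n : ℕ} (k : ℝ → ℝ → ℝ → ℝ) (w : Fin n → ℝ) (y : Fin n → Euc d) (u : Prs n → ℝ)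
    (p : Prs n) : Prop :=
  u p ≤ k (dist (y p.1.1) (y p.1.2)) (w p.1.1) (w p.1.2)

lemma nbF_congr {n : ℕ} {near near' : Fin n → Fin n → Prop} {adj adj' : Prs n → Prop} {V : Type}
    (H : SimpleGraph V) (h : V) (i : Fin n) (h1 : ∀ j, near j i ↔ near' j i)
    (h2 : ∀ p : Prs n, near p.1.1 i → near p.1.2 i → (adj p ↔ adj' p)) :
    nbF near adj H h i ↔ nbF near' adj' H h i := by
  have hs : {j | near j i} = {j | near' j i} := by ext j; exact h1 j
  have key : ∀ S : Set (Fin n), S = {j | near j i} →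
      (gphF adj).induce S = (gphF adj').induce S := by
    intro S hS
    ext ⟨a, ha⟩ ⟨b, hb⟩
    subst hS
    simp only [Set.mem_ofPred_eq] at ha hb
    simp only [SimpleGraph.comap_adj, Function.Embedding.subtype_apply, gphF,
      SimpleGraph.fromRel_adj]
    have e1 : (∃ h : a < b, adj ⟨(a, b), h⟩) ↔ (∃ h : a < b, adj' ⟨(a, b), h⟩) :=
      exists_congr fun h => h2 ⟨(a, b), h⟩ ha hb
    have e2 : (∃ h : b < a, adj ⟨(b, a), h⟩) ↔ (∃ h : b < a, adj' ⟨(b, a), h⟩) :=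
      exists_congr fun h => h2 ⟨(b, a), h⟩ hb ha
    rw [e1, e2]
  unfold nbF
  rw [← hs, key _ rfl]

open Classical in
lemma nbF_card {n : ℕ} {near : Fin n → Fin n → Prop} {adj : Prs n → Prop} {V : Type} [Fintype V]
    {H : SimpleGraph V} {h : V} {i : Fin n} (hh : nbF near adj H h i) :
    (Finset.univ.filter fun j => near j i).card = Fintype.card V := by
  obtain ⟨hi, φ, -⟩ := hh
  rw [← Fintype.card_congr φ.toEquiv]
  simp [Fintype.card_subtype]

open Classical in
lemma packing (d : ℕ) (r : ℝ) (hr : 0 < r) (m : ℕ) : ∃ K : ℕ, ∀ (n : ℕ) (y : Fin n → Euc d)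
    (x : Euc d),
    (Finset.univ.filter fun i => dist (y i) x < r ∧
      (Finset.univ.filter fun j => nearR r y j i).card = m).card ≤ K := by
  obtain ⟨t, -, htf, ht⟩ := (isCompact_closedBall (0 : Euc d) r).finite_cover_balls
    (half_pos hr)
  refine ⟨htf.toFinset.card * m, fun n y x => ?_⟩
  have hsub : (Finset.univ.filter fun i => dist (y i) x < r ∧
      (Finset.univ.filter fun j => nearR r y j i).card = m) ⊆
      htf.toFinset.biUnion fun c => Finset.univ.filter fun i => dist (y i - x) c < r / 2 ∧
        (Finset.univ.filter fun j => nearR r y j i).card = m := by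
    intro i hi
    simp only [Finset.mem_filter, Finset.mem_univ, true_and] at hi
    have : y i - x ∈ Metric.closedBall (0 : Euc d) r := by
      simp only [Metric.mem_closedBall, dist_zero_right]
      rw [← dist_eq_norm]; exact hi.1.le
    obtain ⟨c, hc, hc2⟩ := Set.mem_iUnion₂.1 (ht this)
    simp only [Finset.mem_biUnion, Finset.mem_filter, Finset.mem_univ, true_and,
      Set.Finite.mem_toFinset]
    exact ⟨c, hc, hc2, hi.2⟩
  refine (Finset.card_le_card hsub).trans (Finset.card_biUnion_le_card_mul _ _ _ ?_)
  intro c _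
  rcases Finset.eq_empty_or_nonempty (Finset.univ.filter fun i => dist (y i - x) c < r / 2 ∧
        (Finset.univ.filter fun j => nearR r y j i).card = m) with he | ⟨i, hi⟩
  · rw [he]; simp
  · simp only [Finset.mem_filter, Finset.mem_univ, true_and] at hi
    conv_rhs => rw [← hi.2]
    refine Finset.card_le_card fun j hj => ?_
    simp only [Finset.mem_filter, Finset.mem_univ, true_and] at hj ⊢
    have h1 := dist_triangle_right (y j - x) (y i - x) c
    rw [dist_sub_right] at h1
    unfold nearR
    linarith [hi.1, hj.1]

lemma indic_nonneg (p : Prop) : 0 ≤ indic p := by unfold indic; split_ifs <;> norm_num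
lemma indic_le_one (p : Prop) : indic p ≤ 1 := by unfold indic; split_ifs <;> norm_num

lemma Cf_nonneg {n : ℕ} (near : Fin n → Fin n → Prop) (adj : Prs n → Prop) {V : Type}
    (H : SimpleGraph V) (h : V) : 0 ≤ Cf near adj H h :=
  div_nonneg (Finset.sum_nonneg fun _ _ => indic_nonneg _) (Nat.cast_nonneg _)

lemma Cf_le_one {n : ℕ} (near : Fin n → Fin n → Prop) (adj : Prs n → Prop) {V : Type}
    (H : SimpleGraph V) (h : V) : Cf near adj H h ≤ 1 := by
  refine div_le_one_of_le₀ ?_ (Nat.cast_nonneg _)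
  calc _ ≤ ∑ i : Fin n, (1 : ℝ) := Finset.sum_le_sum fun _ _ => indic_le_one _
    _ = n := by simp

lemma Cf_abs {n : ℕ} (near : Fin n → Fin n → Prop) (adj : Prs n → Prop) {V : Type}
    (H : SimpleGraph V) (h : V) : |Cf near adj H h| ≤ 1 := by
  rw [abs_of_nonneg (Cf_nonneg _ _ _ _)]; exact Cf_le_one _ _ _ _

open Classical in
lemma Cf_diff {n : ℕ} (near near' : Fin n → Fin n → Prop) (adj adj' : Prs n → Prop) {V : Type}
    (H : SimpleGraph V) (h : V) (S : Finset (Fin n))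
    (hS : ∀ i, i ∉ S → (nbF near adj H h i ↔ nbF near' adj' H h i)) :
    |Cf near adj H h - Cf near' adj' H h| ≤ S.card / n := by
  unfold Cf
  rw [← sub_div, abs_div, Nat.abs_cast, ← Finset.sum_sub_distrib]
  gcongr
  calc |∑ i, (indic (nbF near adj H h i) - indic (nbF near' adj' H h i))|
      ≤ ∑ i, |indic (nbF near adj H h i) - indic (nbF near' adj' H h i)| :=
        Finset.abs_sum_le_sum_abs _ _
    _ ≤ ∑ i, (if i ∈ S then (1 : ℝ) else 0) := by
        refine Finset.sum_le_sum fun i _ => ?_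
        split_ifs with hi
        · have := indic_nonneg (nbF near adj H h i)
          have := indic_nonneg (nbF near' adj' H h i)
          have := indic_le_one (nbF near adj H h i)
          have := indic_le_one (nbF near' adj' H h i)
          rw [abs_le]; constructor <;> linarith
        · rw [propext (hS i hi)]; simp
    _ = S.card := by simp

open Classical in
/-- Stability under change of the edges. -/
lemma Cf_diff_adj {d : ℕ} {r : ℝ} {V : Type} [Fintype V] {K : ℕ}
    (hK : ∀ (n : ℕ) (y : Fin n → Euc d) (x : Euc d),
    (Finset.univ.filter fun i => dist (y i) x < r ∧
      (Finset.univ.filter fun j => nearR r y j i).card = Fintype.card V).card ≤ K)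
    (H : SimpleGraph V) (h : V) {n : ℕ} (y : Fin n → Euc d) (adj adj' : Prs n → Prop) :
    |Cf (nearR r y) adj H h - Cf (nearR r y) adj' H h| ≤
      K * ((Finset.univ.filter fun p : Prs n => dist (y p.1.1) (y p.1.2) < 2 * r ∧
        ¬ (adj p ↔ adj' p)).card : ℝ) / n := by
  set T := Finset.univ.filter fun p : Prs n => dist (y p.1.1) (y p.1.2) < 2 * r ∧
        ¬ (adj p ↔ adj' p) with hT
  set S := T.biUnion fun p => Finset.univ.filter fun i => dist (y i) (y p.1.1) < r ∧
      (Finset.univ.filter fun j => nearR r y j i).card = Fintype.card V with hS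
  refine (Cf_diff _ _ adj adj' H h S ?_).trans ?_
  · intro i hi
    by_cases hc : (Finset.univ.filter fun j => nearR r y j i).card = Fintype.card V
    · refine nbF_congr H h i (fun _ => Iff.rfl) fun p hp1 hp2 => ?_
      by_contra hne
      apply hi
      simp only [hS, Finset.mem_biUnion, hT, Finset.mem_filter, Finset.mem_univ, true_and]
      refine ⟨p, ⟨?_, hne⟩, ?_, hc⟩
      · have := dist_triangle_right (y p.1.1) (y p.1.2) (y i)
        unfold nearR at hp1 hp2
        linarith
      · rw [dist_comm]; exact hp1
    · exact ⟨fun h' => absurd (nbF_card h') hc, fun h' => absurd (nbF_card h') hc⟩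
  · gcongr
    have : S.card ≤ T.card * K := Finset.card_biUnion_le_card_mul _ _ _ fun p _ => hK n y _
    rw [mul_comm]
    exact_mod_cast this

open Classical in
/-- Stability under change of a location. -/
lemma Cf_diff_loc {d : ℕ} {r : ℝ} {V : Type} [Fintype V] {K : ℕ}
    (hK : ∀ (n : ℕ) (y : Fin n → Euc d) (x : Euc d),
    (Finset.univ.filter fun i => dist (y i) x < r ∧
      (Finset.univ.filter fun j => nearR r y j i).card = Fintype.card V).card ≤ K)
    (H : SimpleGraph V) (h : V) {n : ℕ} (k : ℝ → ℝ → ℝ → ℝ) (w : Fin n → ℝ) (u : Prs n → ℝ)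
    (y : Fin n → Euc d) (a : Fin n) (x : Euc d) :
    |Cf (nearR r y) (edg k w y u) H h - Cf (nearR r (Function.update y a x))
      (edg k w (Function.update y a x) u) H h| ≤ (1 + 4 * K : ℝ) / n := by
  set y' := Function.update y a x with hy'
  let T : (Fin n → Euc d) → Euc d → Finset (Fin n) := fun y x =>
    Finset.univ.filter fun i => dist (y i) x < r ∧
      (Finset.univ.filter fun j => nearR r y j i).card = Fintype.card V
  set S : Finset (Fin n) := {a} ∪ ((T y (y a) ∪ T y x) ∪ (T y' (y a) ∪ T y' x)) with hS
  have hne : ∀ i, i ≠ a → y' i = y i := fun i hi => Function.update_of_ne hi _ _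
  have haa : y' a = x := Function.update_self _ _ _
  refine (Cf_diff _ _ _ _ H h S ?_).trans ?_
  · intro i hi
    have hia : i ≠ a := by
      rintro rfl; apply hi; simp [hS]
    by_cases hn : dist (y i) (y a) < r ∨ dist (y i) x < r
    · have hc1 : (Finset.univ.filter fun j => nearR r y j i).card ≠ Fintype.card V := by
        intro hc; apply hi
        simp only [hS, T, Finset.mem_union, Finset.mem_filter, Finset.mem_univ, true_and, hc,
          and_true]
        tauto
      have hc2 : (Finset.univ.filter fun j => nearR r y' j i).card ≠ Fintype.card V := by
        intro hc; apply hi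
        simp only [hS, T, Finset.mem_union, Finset.mem_filter, Finset.mem_univ, true_and, hc,
          and_true, hne i hia]
        tauto
      exact ⟨fun h' => absurd (nbF_card h') hc1, fun h' => absurd (nbF_card h') hc2⟩
    · push Not at hn
      have hna : ¬ nearR r y a i := by
        unfold nearR; rw [dist_comm]; exact not_lt.2 hn.1
      have hna' : ¬ nearR r y' a i := by
        unfold nearR; rw [dist_comm, hne i hia, haa]; exact not_lt.2 hn.2
      refine nbF_congr H h i (fun j => ?_) fun p hp1 hp2 => ?_
      · by_cases hj : j = a
        · subst hj; tauto
        · unfold nearR; rw [hne j hj, hne i hia]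
      · unfold edg
        rw [hne _ (fun hh => hna (hh ▸ hp1)), hne _ (fun hh => hna (hh ▸ hp2))]
  · gcongr
    have h1 : S.card ≤ 1 + ((K + K) + (K + K)) := by
      refine (Finset.card_union_le _ _).trans (add_le_add (by simp) ?_)
      refine (Finset.card_union_le _ _).trans (add_le_add ?_ ?_)
      · exact (Finset.card_union_le _ _).trans (add_le_add (hK n y _) (hK n y _))
      · exact (Finset.card_union_le _ _).trans (add_le_add (hK n y' _) (hK n y' _))
    have : (S.card : ℝ) ≤ ((1 + ((K + K) + (K + K)) : ℕ) : ℝ) := by exact_mod_cast h1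
    push_cast at this
    linarith

/-- Measurability of the empirical frequency. -/
lemma Cf_meas {β : Type*} [MeasurableSpace β] {n : ℕ} (near : β → Fin n → Fin n → Prop)
    (adj : β → Prs n → Prop) {V : Type} (H : SimpleGraph V) (h : V)
    (h1 : ∀ i j, MeasurableSet {b | near b i j}) (h2 : ∀ p, MeasurableSet {b | adj b p}) :
    Measurable fun b => Cf (near b) (adj b) H h := by
  have m1 : Measurable fun b => (near b, adj b) := by
    refine Measurable.prodMk ?_ ?_
    · exact measurable_pi_lambda _ fun i => measurable_pi_lambda _ fun j =>
        measurableSet_setOf.1 (h1 i j)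
    · exact measurable_pi_lambda _ fun p => measurableSet_setOf.1 (h2 p)
  have m2 : Measurable fun q : (Fin n → Fin n → Prop) × (Prs n → Prop) => Cf q.1 q.2 H h :=
    Measurable.of_discrete
  exact m2.comp m1

/-- Action of a permutation on pairs. -/
def tauF {n : ℕ} (σ : Equiv.Perm (Fin n)) (p : Prs n) : Prs n :=
  if h : σ p.1.1 < σ p.1.2 then ⟨(σ p.1.1, σ p.1.2), h⟩ else
    ⟨(σ p.1.2, σ p.1.1), lt_of_le_of_ne (not_lt.1 h)
      (fun he => (ne_of_lt p.2) (σ.injective he).symm)⟩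

lemma tauF_inj {n : ℕ} (σ : Equiv.Perm (Fin n)) : Function.Injective (tauF σ) := by
  rintro ⟨⟨a, b⟩, hab⟩ ⟨⟨a', b'⟩, hab'⟩ he
  unfold tauF at he
  simp only at he hab hab'
  split_ifs at he with h1 h2 h2 <;>
    simp only [Subtype.mk.injEq, Prod.mk.injEq, EmbeddingLike.apply_eq_iff_eq] at he ⊢
  · exact he
  · omega
  · omega
  · tauto

/-- The permutation of pairs. -/
def tauE {n : ℕ} (σ : Equiv.Perm (Fin n)) : Prs n ≃ Prs n :=
  Equiv.ofBijective (tauF σ) (Finite.injective_iff_bijective.1 (tauF_inj σ))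

lemma gphF_adj {n : ℕ} (adj : Prs n → Prop) (p : Prs n) :
    (gphF adj).Adj p.1.1 p.1.2 ↔ adj p := by
  unfold gphF
  rw [SimpleGraph.fromRel_adj]
  have := p.2
  constructor
  · rintro ⟨-, ⟨h, h'⟩ | ⟨h, h'⟩⟩
    · exact h'
    · omega
  · intro h
    exact ⟨ne_of_lt p.2, Or.inl ⟨p.2, h⟩⟩

lemma gphF_perm {n : ℕ} (σ : Equiv.Perm (Fin n)) (adj : Prs n → Prop) (a b : Fin n) :
    (gphF fun p => adj (tauF σ p)).Adj a b ↔ (gphF adj).Adj (σ a) (σ b) := by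
  have key : ∀ a b : Fin n, a < b →
      ((gphF fun p => adj (tauF σ p)).Adj a b ↔ (gphF adj).Adj (σ a) (σ b)) := by
    intro a b hab
    have h1 := gphF_adj (fun p => adj (tauF σ p)) ⟨(a, b), hab⟩
    simp only at h1
    rw [h1, ← gphF_adj adj (tauF σ _)]
    unfold tauF
    split_ifs with h
    · rfl
    · exact SimpleGraph.adj_comm _ _ _
  rcases lt_trichotomy a b with h | h | h
  · exact key a b h
  · subst h; simp
  · rw [SimpleGraph.adj_comm, key b a h, SimpleGraph.adj_comm]

lemma nbF_perm {n : ℕ} (σ : Equiv.Perm (Fin n)) (near : Fin n → Fin n → Prop)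
    (adj : Prs n → Prop) {V : Type} (H : SimpleGraph V) (h : V) (i : Fin n) :
    nbF (fun j i => near (σ j) (σ i)) (fun p => adj (tauF σ p)) H h i ↔
      nbF near adj H h (σ i) := by
  let e : (gphF fun p => adj (tauF σ p)).induce {j | near (σ j) (σ i)} ≃g
      (gphF adj).induce {j | near j (σ i)} :=
    { toEquiv := σ.subtypeEquiv (fun a => Iff.rfl)
      map_rel_iff' := by
        rintro ⟨a, ha⟩ ⟨b, hb⟩
        simp only [SimpleGraph.comap_adj, Function.Embedding.subtype_apply,
          Equiv.subtypeEquiv_apply]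
        exact (gphF_perm σ adj a b).symm }
  constructor
  · rintro ⟨hi, φ, hφ⟩
    refine ⟨hi, e.symm.trans φ, ?_⟩
    rw [← hφ]
    simp only [RelIso.trans_apply]
    congr 1
    rw [RelIso.symm_apply_eq]
    rfl
  · rintro ⟨hi, φ, hφ⟩
    refine ⟨hi, e.trans φ, ?_⟩
    rw [← hφ]
    rfl

lemma Cf_perm {n : ℕ} (σ : Equiv.Perm (Fin n)) (near : Fin n → Fin n → Prop)
    (adj : Prs n → Prop) {V : Type} (H : SimpleGraph V) (h : V) :
    Cf (fun j i => near (σ j) (σ i)) (fun p => adj (tauF σ p)) H h = Cf near adj H h := by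
  unfold Cf
  simp_rw [nbF_perm]
  rw [Equiv.sum_comp σ (fun i => indic (nbF near adj H h i))]

lemma edg_perm {d n : ℕ} (σ : Equiv.Perm (Fin n)) (k : ℝ → ℝ → ℝ → ℝ)
    (hk : ∀ t x y, k t x y = k t y x) (w : Fin n → ℝ)
    (y : Fin n → Euc d) (u : Prs n → ℝ) (p : Prs n) :
    edg k (fun i => w (σ i)) (fun i => y (σ i)) (fun p => u (tauF σ p)) p ↔
      edg k w y u (tauF σ p) := by
  unfold edg
  by_cases h : σ p.1.1 < σ p.1.2
  · have : tauF σ p = ⟨(σ p.1.1, σ p.1.2), h⟩ := by unfold tauF; rw [dif_pos h]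
    have h2 : (tauF σ p).1 = (σ p.1.1, σ p.1.2) := by rw [this]
    rw [h2]
  · have : (tauF σ p).1 = (σ p.1.2, σ p.1.1) := by unfold tauF; rw [dif_neg h]
    rw [this, dist_comm, hk]

lemma pi_perm_integral {ι α : Type*} [Fintype ι] [MeasurableSpace α] (μ : Measure α)
    [SigmaFinite μ] (σ : ι ≃ ι) (F : (ι → α) → ℝ) :
    ∫ x, F (fun i => x (σ i)) ∂(Measure.pi fun _ : ι => μ) =
      ∫ x, F x ∂(Measure.pi fun _ : ι => μ) := by
  have hmp := measurePreserving_piCongrLeft (fun _ : ι => μ) σ.symm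
  have hev : ∀ x : ι → α, MeasurableEquiv.piCongrLeft (fun _ : ι => α) σ.symm x =
      fun i => x (σ i) := by
    intro x
    ext i
    obtain ⟨j, rfl⟩ := σ.symm.surjective i
    rw [MeasurableEquiv.coe_piCongrLeft, Equiv.piCongrLeft_apply_apply]
    simp
  rw [← hmp.integral_comp' (g := F)]
  simp_rw [hev]

/-- Conditional mean of the empirical frequency given the weights. -/
def fmean {n : ℕ} (d : ℕ) (r : ℝ) {V : Type} (H : SimpleGraph V) (h : V)
    (k : ℝ → ℝ → ℝ → ℝ) (w : Fin n → ℝ) : ℝ :=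
  ∫ y, ∫ u, Cf (nearR r y) (edg k w y u) H h ∂(Measure.pi fun _ : Prs n => unif01)
    ∂(Measure.pi fun _ : Fin n => unifBox d n)

instance : IsProbabilityMeasure unif01 := ⟨by simp [unif01]⟩


lemma fmean_perm {n d : ℕ} (r : ℝ) {V : Type} (H : SimpleGraph V) (h : V)
    (k : ℝ → ℝ → ℝ → ℝ) (hk : ∀ t x y, k t x y = k t y x) (w : Fin n → ℝ)
    [SigmaFinite (unifBox d n)]
    (σ : Equiv.Perm (Fin n)) :
    fmean d r H h k (fun i => w (σ i)) = fmean d r H h k w := by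
  unfold fmean
  rw [← pi_perm_integral _ σ]
  refine integral_congr_ae (Eventually.of_forall fun y => ?_)
  simp only
  rw [← pi_perm_integral _ (tauE σ)]
  refine integral_congr_ae (Eventually.of_forall fun u => ?_)
  simp only
  have h1 : (fun p => u (tauE σ p)) = fun p => u (tauF σ p) := rfl
  have h2 : edg k (fun i => w (σ i)) (fun i => y (σ i)) (fun p => u (tauE σ p)) =
      fun p => edg k w y u (tauF σ p) := by
    ext p; rw [h1]; exact edg_perm σ k hk w y u p
  rw [h2]
  exact Cf_perm σ (nearR r y) (edg k w y u) H h

lemma unifBox_prob {d n : ℕ} (hd : 1 ≤ d) (hn : 0 < n) : IsProbabilityMeasure (unifBox d n) := by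
  constructor
  have h1 : boxIn d n = (WithLp.ofLp : Euc d → (Fin d → ℝ)) ⁻¹'
      (Set.pi Set.univ fun _ => Set.Icc (-((n : ℝ) ^ ((1 : ℝ) / d) / 2))
        ((n : ℝ) ^ ((1 : ℝ) / d) / 2)) := by
    ext x
    simp only [boxIn, abs_le, Set.mem_preimage, Set.mem_pi, Set.mem_univ, true_imp_iff, Set.mem_Icc]
    rfl
  have h2 : volume (boxIn d n) = n := by
    rw [h1, (PiLp.volume_preserving_ofLp (Fin d)).measure_preimage
      (MeasurableSet.univ_pi fun _ => measurableSet_Icc).nullMeasurableSet, volume_pi_pi]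
    simp only [Real.volume_Icc, Finset.prod_const, Finset.card_univ, Fintype.card_fin]
    have : (n : ℝ) ^ ((1 : ℝ) / d) / 2 - -((n : ℝ) ^ ((1 : ℝ) / d) / 2) =
      (n : ℝ) ^ ((1 : ℝ) / d) := by ring
    rw [this, ← ENNReal.ofReal_pow (by positivity), ← Real.rpow_natCast, ← Real.rpow_mul (by positivity)]
    have hd' : (d : ℝ) ≠ 0 := by positivity
    rw [one_div, inv_mul_cancel₀ hd', Real.rpow_one]
    simp
  unfold unifBox
  rw [Measure.smul_apply, Measure.restrict_apply_univ, h2, smul_eq_mul]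
  exact ENNReal.inv_mul_cancel (by simp; omega) (by simp)

lemma unifBox_le (d n : ℕ) : unifBox d n ≤ (n : ℝ≥0∞)⁻¹ • volume := by
  unfold unifBox
  gcongr
  exact Measure.restrict_le_self

lemma pair_bound {d n : ℕ} [IsProbabilityMeasure (unifBox d n)] {i j : Fin n} (hij : i ≠ j)
    (g : Euc d → ℝ≥0∞) (hg : Measurable g) :
    ∫⁻ y, g (y i - y j) ∂(Measure.pi fun _ : Fin n => unifBox d n) ≤
      (n : ℝ≥0∞)⁻¹ * ∫⁻ z, g z := by
  have hind : IndepFun (fun y : Fin n → Euc d => y i) (fun y => y j)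
      (Measure.pi fun _ : Fin n => unifBox d n) :=
    (iIndepFun_pi (μ := fun _ : Fin n => unifBox d n) (X := fun _ => id)
      (fun _ => aemeasurable_id)).indepFun hij
  have hmap := (indepFun_iff_map_prod_eq_prod_map_map (measurable_pi_apply i).aemeasurable
    (measurable_pi_apply j).aemeasurable).1 hind
  rw [(measurePreserving_eval (fun _ : Fin n => unifBox d n) i).map_eq,
    (measurePreserving_eval (fun _ : Fin n => unifBox d n) j).map_eq] at hmap
  have hgm : Measurable fun p : Euc d × Euc d => g (p.1 - p.2) := by fun_prop
  have h1 : ∫⁻ y, g (y i - y j) ∂(Measure.pi fun _ : Fin n => unifBox d n) =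
      ∫⁻ p, g (p.1 - p.2) ∂((unifBox d n).prod (unifBox d n)) := by
    rw [← hmap, lintegral_map hgm (by fun_prop)]
  rw [h1, lintegral_prod_symm' _ hgm]
  calc ∫⁻ y, ∫⁻ x, g (x - y) ∂(unifBox d n) ∂(unifBox d n)
      ≤ ∫⁻ y, ∫⁻ x, g (x - y) ∂((n : ℝ≥0∞)⁻¹ • (volume : Measure (Euc d))) ∂(unifBox d n) := by
        gcongr
        exact unifBox_le d n
    _ = ∫⁻ y, ((n : ℝ≥0∞)⁻¹ * ∫⁻ z, g z) ∂(unifBox d n) := by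
        refine lintegral_congr fun y => ?_
        rw [lintegral_smul_measure, lintegral_sub_right_eq_self g y, smul_eq_mul]
    _ = _ := by simp

lemma unif01_xor (a b : ℝ) :
    unif01 {u | ¬ (u ≤ a ↔ u ≤ b)} ≤ ENNReal.ofReal (min 1 |a - b|) := by
  rw [ENNReal.ofReal_min]
  refine le_min (by simpa using prob_le_one) ?_
  calc unif01 {u | ¬ (u ≤ a ↔ u ≤ b)} ≤ volume {u | ¬ (u ≤ a ↔ u ≤ b)} :=
        Measure.restrict_apply_le _ _
    _ ≤ volume (Set.Icc (min a b) (max a b)) := by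
        refine measure_mono fun u hu => ?_
        have hu' : ¬ (u ≤ a ↔ u ≤ b) := hu
        simp only [Set.mem_Icc, min_le_iff, le_max_iff]
        by_cases h1 : u ≤ a <;> by_cases h2 : u ≤ b
        · tauto
        · exact ⟨Or.inr (not_le.1 h2).le, Or.inl h1⟩
        · exact ⟨Or.inl (not_le.1 h1).le, Or.inr h2⟩
        · tauto
    _ = ENNReal.ofReal |a - b| := by
        rw [Real.volume_Icc, max_sub_min_eq_abs, abs_sub_comm]

/-- Measurability in all variables jointly. -/
lemma Cf_meas3 {d n : ℕ} (r : ℝ) {V : Type} (H : SimpleGraph V) (h : V)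
    (k : ℝ → ℝ → ℝ → ℝ) (hk : Measurable fun p : ℝ × ℝ × ℝ => k p.1 p.2.1 p.2.2) :
    Measurable fun q : (Fin n → Euc d) × (Fin n → ℝ) × (Prs n → ℝ) =>
      Cf (nearR r q.1) (edg k q.2.1 q.1 q.2.2) H h := by
  refine Cf_meas (fun q : (Fin n → Euc d) × (Fin n → ℝ) × (Prs n → ℝ) => nearR r q.1)
    (fun q => edg k q.2.1 q.1 q.2.2) H h (fun i j => ?_) (fun p => ?_)
  · unfold nearR
    exact measurableSet_lt (by fun_prop) measurable_const
  · unfold edg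
    refine measurableSet_le (by fun_prop) ?_
    exact hk.comp (f := fun q : (Fin n → Euc d) × (Fin n → ℝ) × (Prs n → ℝ) =>
      (dist (q.1 p.1.1) (q.1 p.1.2), q.2.1 p.1.1, q.2.1 p.1.2)) (by fun_prop)

lemma Cf_meas2 {d n : ℕ} (r : ℝ) {V : Type} (H : SimpleGraph V) (h : V)
    (k : ℝ → ℝ → ℝ → ℝ) (hk : Measurable fun p : ℝ × ℝ × ℝ => k p.1 p.2.1 p.2.2)
    (w : Fin n → ℝ) :
    Measurable fun q : (Fin n → Euc d) × (Prs n → ℝ) =>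
      Cf (nearR r q.1) (edg k w q.1 q.2) H h :=
  (Cf_meas3 r H h k hk).comp (f := fun q : (Fin n → Euc d) × (Prs n → ℝ) => (q.1, w, q.2))
    (by fun_prop)

lemma Cf_meas1 {d n : ℕ} (r : ℝ) {V : Type} (H : SimpleGraph V) (h : V)
    (k : ℝ → ℝ → ℝ → ℝ) (hk : Measurable fun p : ℝ × ℝ × ℝ => k p.1 p.2.1 p.2.2)
    (w : Fin n → ℝ) (y : Fin n → Euc d) :
    Measurable fun u : Prs n → ℝ => Cf (nearR r y) (edg k w y u) H h :=
  (Cf_meas2 r H h k hk w).comp (f := fun u : Prs n → ℝ => (y, u)) (by fun_prop)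

lemma Cf_int_meas {d n : ℕ} (r : ℝ) {V : Type} (H : SimpleGraph V) (h : V)
    (k : ℝ → ℝ → ℝ → ℝ) (hk : Measurable fun p : ℝ × ℝ × ℝ => k p.1 p.2.1 p.2.2)
    (w : Fin n → ℝ) :
    Measurable fun y : Fin n → Euc d =>
      ∫ u, Cf (nearR r y) (edg k w y u) H h ∂(Measure.pi fun _ : Prs n => unif01) := by
  have := ((Cf_meas2 (d := d) r H h k hk w).stronglyMeasurable.integral_prod_right'
    (ν := Measure.pi fun _ : Prs n => unif01)).measurable
  exact this

lemma fmean_sub {d n : ℕ} (r : ℝ) {V : Type} [IsProbabilityMeasure (unifBox d n)]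
    (H : SimpleGraph V) (h : V) (k : ℝ → ℝ → ℝ → ℝ)
    (hk : Measurable fun p : ℝ × ℝ × ℝ => k p.1 p.2.1 p.2.2) (w w' : Fin n → ℝ) :
    fmean d r H h k w - fmean d r H h k w' = ∫ y, ∫ u,
      (Cf (nearR r y) (edg k w y u) H h - Cf (nearR r y) (edg k w' y u) H h)
        ∂(Measure.pi fun _ : Prs n => unif01) ∂(Measure.pi fun _ : Fin n => unifBox d n) := by
  unfold fmean
  rw [← integral_sub (bd_integrable (Cf_int_meas r H h k hk w)
      fun y => abs_int_le fun u => Cf_abs _ _ _ _)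
    (bd_integrable (Cf_int_meas r H h k hk w') fun y => abs_int_le fun u => Cf_abs _ _ _ _)]
  refine integral_congr_ae (Eventually.of_forall fun y => ?_)
  simp only
  rw [integral_sub (bd_integrable (Cf_meas1 r H h k hk w y) fun _ => Cf_abs _ _ _ _)
    (bd_integrable (Cf_meas1 r H h k hk w' y) fun _ => Cf_abs _ _ _ _)]

/-- Discrepancy between two weight sequences at a pair of indices. -/
def psiF (d : ℕ) (r : ℝ) (k : ℝ → ℝ → ℝ → ℝ) (a b a' b' : ℝ) : ℝ≥0∞ :=
  ∫⁻ z in Metric.ball (0 : Euc d) (2 * r),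
    ENNReal.ofReal (min 1 |k ‖z‖ a b - k ‖z‖ a' b'|)

open Classical in
lemma fmean_diff {d n : ℕ} {r : ℝ} {V : Type} [Fintype V] {K : ℕ}
    [IsProbabilityMeasure (unifBox d n)] (hn : 0 < n)
    (hK : ∀ (n : ℕ) (y : Fin n → Euc d) (x : Euc d),
    (Finset.univ.filter fun i => dist (y i) x < r ∧
      (Finset.univ.filter fun j => nearR r y j i).card = Fintype.card V).card ≤ K)
    (H : SimpleGraph V) (h : V) (k : ℝ → ℝ → ℝ → ℝ)
    (hk : Measurable fun p : ℝ × ℝ × ℝ => k p.1 p.2.1 p.2.2) (w w' : Fin n → ℝ) :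
    ENNReal.ofReal |fmean d r H h k w - fmean d r H h k w'| ≤
      K * ((n : ℝ≥0∞)⁻¹ * ((n : ℝ≥0∞)⁻¹ * ∑ i, ∑ j, psiF d r k (w i) (w j) (w' i) (w' j))) := by
  set νU := Measure.pi fun _ : Prs n => unif01
  set νY := Measure.pi fun _ : Fin n => unifBox d n
  have e2 : ENNReal.ofReal |fmean d r H h k w - fmean d r H h k w'| ≤ ∫⁻ y, ∫⁻ u,
      ENNReal.ofReal
        |Cf (nearR r y) (edg k w y u) H h - Cf (nearR r y) (edg k w' y u) H h| ∂νU ∂νY := by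
    rw [fmean_sub r H h k hk w w', ← Real.enorm_eq_ofReal_abs]
    refine (enorm_integral_le_lintegral_enorm _).trans (lintegral_mono fun y => ?_)
    refine (enorm_integral_le_lintegral_enorm _).trans (lintegral_mono fun u => ?_)
    rw [Real.enorm_eq_ofReal_abs]
  refine e2.trans ?_
  let G : Prs n → Euc d → ℝ≥0∞ := fun p => Set.indicator (Metric.ball (0 : Euc d) (2 * r))
    fun z => ENNReal.ofReal (min 1 |k ‖z‖ (w p.1.1) (w p.1.2) - k ‖z‖ (w' p.1.1) (w' p.1.2)|)
  have hkm : ∀ a b : ℝ, Measurable fun z : Euc d => k ‖z‖ a b := fun a b =>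
    hk.comp (f := fun z : Euc d => (‖z‖, a, b)) (by fun_prop)
  have hG : ∀ p, Measurable (G p) := by
    intro p
    refine Measurable.indicator ?_ measurableSet_ball
    have := hkm (w p.1.1) (w p.1.2)
    have := hkm (w' p.1.1) (w' p.1.2)
    fun_prop
  have e3 : ∀ y : Fin n → Euc d, ∫⁻ u, ENNReal.ofReal
        |Cf (nearR r y) (edg k w y u) H h - Cf (nearR r y) (edg k w' y u) H h| ∂νU ≤
      (K * (n : ℝ≥0∞)⁻¹) * ∑ p : Prs n, G p (y p.1.1 - y p.1.2) := by
    intro y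
    let D : Prs n → Set (Prs n → ℝ) := fun p => {u | dist (y p.1.1) (y p.1.2) < 2 * r ∧
        ¬ (edg k w y u p ↔ edg k w' y u p)}
    have hD : ∀ p, MeasurableSet (D p) := by
      intro p
      refine MeasurableSet.inter (MeasurableSet.const _) ?_
      have m1 : MeasurableSet {u | edg k w y u p} :=
        measurableSet_le (by fun_prop) measurable_const
      have m2 : MeasurableSet {u | edg k w' y u p} :=
        measurableSet_le (by fun_prop) measurable_const
      exact (m1.iff m2).compl
    calc _ ≤ ∫⁻ u, (K * (n : ℝ≥0∞)⁻¹) * ∑ p : Prs n, (D p).indicator 1 u ∂νU := by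
          refine lintegral_mono fun u => ?_
          refine (ENNReal.ofReal_le_ofReal (Cf_diff_adj hK H h y _ _)).trans ?_
          rw [mul_div_right_comm, ENNReal.ofReal_mul (by positivity),
            ENNReal.ofReal_div_of_pos (by exact_mod_cast hn)]
          simp only [ENNReal.ofReal_natCast]
          rw [ENNReal.div_eq_inv_mul, mul_comm (n : ℝ≥0∞)⁻¹]
          gcongr
          simp [Set.indicator_apply, D]
      _ = (K * (n : ℝ≥0∞)⁻¹) * ∑ p : Prs n, νU (D p) := by
          rw [lintegral_const_mul _ (by
            refine Finset.measurable_sum _ fun p _ => measurable_one.indicator (hD p)),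
            lintegral_finsetSum _ fun p _ => measurable_one.indicator (hD p)]
          simp_rw [lintegral_indicator_one (hD _)]
      _ ≤ _ := by
          gcongr with p _
          by_cases hp : dist (y p.1.1) (y p.1.2) < 2 * r
          · have hmem : y p.1.1 - y p.1.2 ∈ Metric.ball (0 : Euc d) (2 * r) := by
              simpa [← dist_eq_norm] using hp
            simp only [G, Set.indicator_of_mem hmem]
            rw [← dist_eq_norm]
            refine le_trans ?_ (unif01_xor _ _)
            rw [← (measurePreserving_eval (fun _ : Prs n => unif01) p).measure_preimage]
            · refine measure_mono fun u hu => ?_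
              exact hu.2
            · have m1 : ∀ c : ℝ, MeasurableSet {u : ℝ | u ≤ c} := fun c => measurableSet_Iic
              exact ((m1 _).iff (m1 _)).compl.nullMeasurableSet
          · have : D p = ∅ := by
              ext u; simp [D, hp]
            rw [this]; simp
  calc _ ≤ ∫⁻ y, (K * (n : ℝ≥0∞)⁻¹) * ∑ p : Prs n, G p (y p.1.1 - y p.1.2) ∂νY :=
        lintegral_mono e3
    _ = (K * (n : ℝ≥0∞)⁻¹) * ∑ p : Prs n, ∫⁻ y, G p (y p.1.1 - y p.1.2) ∂νY := by
        have : ∀ p : Prs n, Measurable fun y : Fin n → Euc d => G p (y p.1.1 - y p.1.2) :=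
          fun p => (hG p).comp (by fun_prop)
        rw [lintegral_const_mul _ (Finset.measurable_sum _ fun p _ => this p),
          lintegral_finsetSum _ fun p _ => this p]
    _ ≤ (K * (n : ℝ≥0∞)⁻¹) * ∑ p : Prs n, (n : ℝ≥0∞)⁻¹ *
          psiF d r k (w p.1.1) (w p.1.2) (w' p.1.1) (w' p.1.2) := by
        gcongr with p _
        refine (pair_bound (ne_of_lt p.2) (G p) (hG p)).trans_eq ?_
        rw [lintegral_indicator measurableSet_ball]
        rfl
    _ ≤ _ := by
        rw [← Finset.mul_sum, mul_assoc]
        gcongr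
        rw [← Finset.sum_product' (f := fun i j => psiF d r k (w i) (w j) (w' i) (w' j)),
          Finset.univ_product_univ]
        rw [← Finset.sum_subtype (p := fun q : Fin n × Fin n => q.1 < q.2)
          (Finset.univ.filter fun q : Fin n × Fin n => q.1 < q.2) (by simp)
          (fun q : Fin n × Fin n => psiF d r k (w q.1) (w q.2) (w' q.1) (w' q.2))]
        exact Finset.sum_le_sum_of_subset (Finset.subset_univ _)

lemma near_prob {d n : ℕ} [IsProbabilityMeasure (unifBox d n)] (r : ℝ) {i j : Fin n}
    (hij : i ≠ j) :
    ∫ y : Fin n → Euc d, indic (dist (y i) (y j) < 2 * r)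
        ∂(Measure.pi fun _ : Fin n => unifBox d n) ≤
      volume.real (Metric.ball (0 : Euc d) (2 * r)) / n := by
  have hms : MeasurableSet {y : Fin n → Euc d | dist (y i) (y j) < 2 * r} :=
    measurableSet_lt (by fun_prop) measurable_const
  have h0 : (fun y : Fin n → Euc d => indic (dist (y i) (y j) < 2 * r)) =
      {y : Fin n → Euc d | dist (y i) (y j) < 2 * r}.indicator 1 := by
    ext y; simp [indic, Set.indicator_apply]
  rw [h0, integral_indicator_one hms]
  have h1 := pair_bound hij ((Metric.ball (0 : Euc d) (2 * r)).indicator 1)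
    (measurable_one.indicator measurableSet_ball)
  rw [lintegral_indicator_one measurableSet_ball] at h1
  have h2 : (fun y : Fin n → Euc d => (Metric.ball (0 : Euc d) (2 * r)).indicator
      (1 : Euc d → ℝ≥0∞) (y i - y j)) =
      {y : Fin n → Euc d | dist (y i) (y j) < 2 * r}.indicator 1 := by
    ext y
    by_cases hy : dist (y i) (y j) < 2 * r
    · rw [Set.indicator_of_mem (by simpa [dist_eq_norm] using hy), Set.indicator_of_mem (show y ∈ {y : Fin n → Euc d | dist (y i) (y j) < 2 * r} from hy)]
      rfl
    · rw [Set.indicator_of_notMem (by simpa [dist_eq_norm] using hy), Set.indicator_of_notMem (show y ∉ {y : Fin n → Euc d | dist (y i) (y j) < 2 * r} from hy)]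
  rw [h2, lintegral_indicator_one hms] at h1
  have h3 := ENNReal.toReal_mono ?_ h1
  · rw [ENNReal.toReal_mul] at h3
    simpa [Measure.real, div_eq_inv_mul] using h3
  · have : 0 < n := i.pos
    exact ENNReal.mul_ne_top (by simp; omega) measure_ball_lt_top.ne

open Classical in
lemma var_bound {d n : ℕ} {r : ℝ} {V : Type} [Fintype V] {K : ℕ}
    [IsProbabilityMeasure (unifBox d n)] (hn : 0 < n)
    (hK : ∀ (n : ℕ) (y : Fin n → Euc d) (x : Euc d),
    (Finset.univ.filter fun i => dist (y i) x < r ∧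
      (Finset.univ.filter fun j => nearR r y j i).card = Fintype.card V).card ≤ K)
    (H : SimpleGraph V) (h : V) (k : ℝ → ℝ → ℝ → ℝ)
    (hk : Measurable fun p : ℝ × ℝ × ℝ => k p.1 p.2.1 p.2.2) (w : Fin n → ℝ) (a : ℝ) :
    ∫ y, ∫ u, (Cf (nearR r y) (edg k w y u) H h - a) ^ 2 ∂(Measure.pi fun _ : Prs n => unif01)
      ∂(Measure.pi fun _ : Fin n => unifBox d n) ≤
      (K ^ 2 * volume.real (Metric.ball (0 : Euc d) (2 * r)) + (1 + 4 * K) ^ 2) / n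
        + (fmean d r H h k w - a) ^ 2 := by
  have hn' : (0 : ℝ) < n := by exact_mod_cast hn
  have hvi : Integrable (fun y : Fin n → Euc d => ∑ p : Prs n,
      (K / n * indic (dist (y p.1.1) (y p.1.2) < 2 * r)) ^ 2)
      (Measure.pi fun _ : Fin n => unifBox d n) := by
    refine integrable_finsetSum _ fun p _ => ?_
    refine bd_integrable (B := (K / n) ^ 2) ?_ ?_
    · unfold indic
      refine (Measurable.const_mul (Measurable.ite (measurableSet_lt (by fun_prop)
        measurable_const) measurable_const measurable_const) _).pow_const _
    · intro y
      rw [abs_of_nonneg (sq_nonneg _)]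
      have := indic_nonneg (dist (y p.1.1) (y p.1.2) < 2 * r)
      have := indic_le_one (dist (y p.1.1) (y p.1.2) < 2 * r)
      have : (0 : ℝ) ≤ K / n := by positivity
      gcongr
      nlinarith
  have h1 := es_prod (μ := Measure.pi fun _ : Fin n => unifBox d n)
    (ν := Measure.pi fun _ : Prs n => unif01)
    (f := fun y u => Cf (nearR r y) (edg k w y u) H h) (Cf_meas2 r H h k hk w)
    (fun y u => Cf_abs _ _ _ _) a _ hvi (by
      intro y
      refine es_pi _ (Cf_meas1 r H h k hk w y) 1 (fun u => Cf_abs _ _ _ _) _ ?_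
      intro u p b
      refine (Cf_diff_adj hK H h y _ _).trans ?_
      rw [mul_div_right_comm]
      gcongr
      by_cases hp : dist (y p.1.1) (y p.1.2) < 2 * r
      · have : indic (dist (y p.1.1) (y p.1.2) < 2 * r) = 1 := by simp [indic, hp]
        rw [this]
        have hsub : (Finset.univ.filter fun q : Prs n => dist (y q.1.1) (y q.1.2) < 2 * r ∧
          ¬ (edg k w y u q ↔ edg k w y (Function.update u p b) q)) ⊆ {p} := by
          intro q hq
          simp only [Finset.mem_filter, Finset.mem_univ, true_and] at hq
          rw [Finset.mem_singleton]
          by_contra hne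
          apply hq.2
          unfold edg
          rw [Function.update_of_ne hne]
        have := Finset.card_le_card hsub
        rw [Finset.card_singleton] at this
        exact_mod_cast this
      · have : indic (dist (y p.1.1) (y p.1.2) < 2 * r) = 0 := by simp [indic, hp]
        rw [this]
        have hsub : (Finset.univ.filter fun q : Prs n => dist (y q.1.1) (y q.1.2) < 2 * r ∧
          ¬ (edg k w y u q ↔ edg k w y (Function.update u p b) q)) = ∅ := by
          ext q
          simp only [Finset.mem_filter, Finset.mem_univ, true_and, Finset.notMem_empty, iff_false]
          rintro ⟨hq1, hq2⟩
          by_cases hne : q = p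
          · subst hne; exact hp hq1
          · apply hq2
            unfold edg
            rw [Function.update_of_ne hne]
        rw [hsub]; simp)
  refine h1.trans ?_
  have h2 : ∫ y : Fin n → Euc d, ∑ p : Prs n,
      (K / n * indic (dist (y p.1.1) (y p.1.2) < 2 * r)) ^ 2
      ∂(Measure.pi fun _ : Fin n => unifBox d n) ≤
      K ^ 2 * volume.real (Metric.ball (0 : Euc d) (2 * r)) / n := by
    have hsq : ∀ q : Prop, indic q ^ 2 = indic q := by
      intro q; unfold indic; split_ifs <;> norm_num
    simp_rw [mul_pow, hsq]
    rw [integral_finsetSum]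
    · simp_rw [integral_const_mul]
      calc ∑ p : Prs n, ((K : ℝ) / n) ^ 2 * ∫ y : Fin n → Euc d,
            indic (dist (y p.1.1) (y p.1.2) < 2 * r) ∂(Measure.pi fun _ : Fin n => unifBox d n)
          ≤ ∑ p : Prs n, ((K : ℝ) / n) ^ 2 *
              (volume.real (Metric.ball (0 : Euc d) (2 * r)) / n) := by
            gcongr with p _
            exact near_prob r (ne_of_lt p.2)
        _ = (Fintype.card (Prs n) : ℝ) * (((K : ℝ) / n) ^ 2 *
              (volume.real (Metric.ball (0 : Euc d) (2 * r)) / n)) := by simp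
        _ ≤ (n : ℝ) ^ 2 * (((K : ℝ) / n) ^ 2 *
              (volume.real (Metric.ball (0 : Euc d) (2 * r)) / n)) := by
            gcongr
            have : Fintype.card (Prs n) ≤ Fintype.card (Fin n × Fin n) :=
              Fintype.card_subtype_le _
            simp only [Fintype.card_prod, Fintype.card_fin] at this
            rw [sq]
            exact_mod_cast this
        _ = _ := by field_simp
    · intro p _
      refine Integrable.const_mul (bd_integrable (B := 1) ?_ ?_) _
      · unfold indic
        exact Measurable.ite (measurableSet_lt (by fun_prop)
          measurable_const) measurable_const measurable_const
      · intro y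
        rw [abs_of_nonneg (indic_nonneg _)]
        exact indic_le_one _
  have h3 := bd_sq_dec (μ := Measure.pi fun _ : Fin n => unifBox d n)
    (Cf_int_meas (d := d) r H h k hk w) (fun y => abs_int_le fun u => Cf_abs _ _ _ _) a
  have h4 := es_pi (μ := unifBox d n) _ (Cf_int_meas (d := d) r H h k hk w) 1
    (fun y => abs_int_le fun u => Cf_abs _ _ _ _) (fun _ => (1 + 4 * K : ℝ) / n) (by
      intro y i x
      rw [← integral_sub (bd_integrable (Cf_meas1 r H h k hk w _) fun _ => Cf_abs _ _ _ _)
        (bd_integrable (Cf_meas1 r H h k hk w _) fun _ => Cf_abs _ _ _ _)]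
      exact abs_int_le fun u => Cf_diff_loc hK H h k w u y i x)
  rw [h3]
  have h5 : ∑ i : Fin n, ((1 + 4 * K : ℝ) / n) ^ 2 = (1 + 4 * K) ^ 2 / n := by
    simp; field_simp
  rw [h5] at h4
  have h6 : (K ^ 2 * volume.real (Metric.ball (0 : Euc d) (2 * r)) + (1 + 4 * K) ^ 2) / n =
    K ^ 2 * volume.real (Metric.ball (0 : Euc d) (2 * r)) / n + (1 + 4 * K : ℝ) ^ 2 / n :=
    add_div _ _ _
  rw [h6]
  unfold fmean
  linarith

lemma ae_norm {d : ℕ} (hd : 1 ≤ d) {p : ℝ → Prop} (hp : ∀ᵐ t ∂(volume : Measure ℝ), 0 < t → p t) :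
    ∀ᵐ z ∂(volume : Measure (Euc d)), p ‖z‖ := by
  haveI : Nontrivial (Euc d) := by
    haveI : Nonempty (Fin d) := ⟨⟨0, hd⟩⟩
    infer_instance
  set S := toMeasurable volume {t : ℝ | ¬ (0 < t → p t)} with hS
  have hS0 : volume S = 0 := by rw [hS, measure_toMeasurable]; exact hp
  have hSm : MeasurableSet S := measurableSet_toMeasurable _ _
  set f : ℝ → ℝ := S.indicator 1 with hf
  have hf0 : f =ᵐ[volume] 0 := indicator_meas_zero hS0
  have hg0 : (fun y : ℝ => y ^ (Module.finrank ℝ (Euc d) - 1) • f y) =ᵐ[volume.restrict (Set.Ioi 0)] 0 := by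
    filter_upwards [ae_restrict_of_ae hf0] with y hy
    simp [hy]
  have hi : Integrable (fun z : Euc d => f ‖z‖) volume := by
    rw [integrable_fun_norm_addHaar]
    exact (integrable_congr hg0).2 (integrable_zero _ _ _)
  have h0 : ∫ z : Euc d, f ‖z‖ = 0 := by
    rw [integral_fun_norm_addHaar, integral_congr_ae hg0]
    simp
  rw [integral_eq_zero_iff_of_nonneg (fun z => Set.indicator_nonneg (by simp) _) hi] at h0
  have hne : ∀ᵐ z ∂(volume : Measure (Euc d)), z ≠ 0 := by
    simp [ae_iff]
  filter_upwards [h0, hne] with z hz hz0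
  by_contra hc
  have : ‖z‖ ∈ S := subset_toMeasurable _ _ (by
    show ¬ (0 < ‖z‖ → p ‖z‖)
    intro h; exact hc (h (norm_pos_iff.2 hz0)))
  simp [hf, this] at hz

lemma step_sum {n : ℕ} (hn : 0 < n) (g : ℕ → ℝ≥0∞) :
    (n : ℝ≥0∞)⁻¹ * ∑ i : Fin n, g i ≤ ∫⁻ s, g ⌊(n : ℝ) * s⌋₊ ∂unif01 := by
  have hn' : (0 : ℝ) < n := by exact_mod_cast hn
  have hm : Measurable fun s : ℝ => ⌊(n : ℝ) * s⌋₊ :=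
    Nat.measurable_floor.comp (measurable_const.mul measurable_id)
  rw [← lintegral_map (μ := unif01) (f := g) (g := fun s : ℝ => ⌊(n : ℝ) * s⌋₊)
    (measurable_from_nat) hm, lintegral_countable']
  refine le_trans ?_ (ENNReal.sum_le_tsum (Finset.range n))
  rw [Finset.mul_sum, ← Fin.sum_univ_eq_sum_range (fun i => g i * _) n]
  refine Finset.sum_le_sum fun i _ => ?_
  rw [mul_comm]
  gcongr
  rw [Measure.map_apply hm (measurableSet_singleton _), unif01,
    Measure.restrict_apply (hm (measurableSet_singleton _))]
  have hsub : Set.Ico ((i : ℝ) / n) (((i : ℝ) + 1) / n) ⊆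
      (fun s : ℝ => ⌊(n : ℝ) * s⌋₊) ⁻¹' {(i : ℕ)} ∩ Set.Icc 0 1 := by
    intro s hs
    have h0 : (0 : ℝ) ≤ (i : ℝ) / n := by positivity
    have h1 := hs.1
    have h2 := hs.2
    rw [div_le_iff₀ hn'] at h1
    rw [lt_div_iff₀ hn'] at h2
    have h3 : ((i : ℕ) : ℝ) + 1 ≤ n := by exact_mod_cast i.2
    refine ⟨?_, h0.trans hs.1, ?_⟩
    · show ⌊(n : ℝ) * s⌋₊ = i
      rw [Nat.floor_eq_iff (by nlinarith [hs.1])]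
      constructor <;> linarith
    · nlinarith
  refine le_trans ?_ (measure_mono hsub)
  rw [Real.volume_Ico]
  have : ((i : ℝ) + 1) / n - (i : ℝ) / n = (n : ℝ)⁻¹ := by field_simp; ring
  rw [this, ENNReal.ofReal_inv_of_pos hn', ENNReal.ofReal_natCast]

def Qf (F : ℝ → ℝ) (s : ℝ) : ℝ := sInf {x | s ≤ F x}

lemma Qf_conv {F : ℝ → ℝ} (hF : Monotone F) (h0 : Tendsto F atBot (𝓝 0))
    (h1 : Tendsto F atTop (𝓝 1)) {s : ℝ} (hs : s ∈ Set.Ioo (0 : ℝ) 1)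
    (hsF : ∀ q : ℚ, F q ≠ s) {D : Set ℝ} (hD : Dense D) (v : ℕ → ℝ)
    (hu : ∀ x ∈ D, s < F x → ∀ᶠ k in atTop, v k ≤ x)
    (hl : ∀ x ∈ D, F x < s → ∀ᶠ k in atTop, x ≤ v k) :
    Tendsto v atTop (𝓝 (Qf F s)) := by
  have hne : {x | s ≤ F x}.Nonempty := by
    obtain ⟨x, hx⟩ := (h1.eventually (lt_mem_nhds hs.2)).exists
    exact ⟨x, hx.le⟩
  have hgt : ∀ x, Qf F s < x → s < F x := by
    intro x hx
    obtain ⟨q, hq1, hq2⟩ := exists_rat_btwn hx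
    obtain ⟨y, hy1, hy2⟩ := exists_lt_of_csInf_lt hne hq1
    have : s ≤ F q := le_trans hy1 (hF hy2.le)
    exact lt_of_lt_of_le (lt_of_le_of_ne this (hsF q).symm) (hF hq2.le)
  have hbd : BddBelow {x | s ≤ F x} := by
    obtain ⟨x, hx⟩ := (h0.eventually (gt_mem_nhds hs.1)).exists
    refine ⟨x, fun y hy => ?_⟩
    by_contra hc
    exact absurd (le_trans hy (hF (not_le.1 hc).le)) (not_le.2 hx)
  have hlt : ∀ x, x < Qf F s → F x < s := by
    intro x hx
    exact not_le.1 (fun hc => notMem_of_lt_csInf hx hbd hc)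
  rw [tendsto_order]
  constructor
  · intro a ha
    obtain ⟨x, hxD, hx1, hx2⟩ := hD.exists_between ha
    filter_upwards [hl x hxD (hlt x hx2)] with k hk
    exact hx1.trans_le hk
  · intro a ha
    obtain ⟨x, hxD, hx1, hx2⟩ := hD.exists_between ha
    filter_upwards [hu x hxD (hgt x hx1)] with k hk
    exact hk.trans_lt hx2

/-- convergence of the quantile grid -/
lemma grid_conv {F : ℝ → ℝ} (hF : Monotone F) (h0 : Tendsto F atBot (𝓝 0))
    (h1 : Tendsto F atTop (𝓝 1)) {s : ℝ} (hs : s ∈ Set.Ioo (0 : ℝ) 1)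
    (hsF : ∀ q : ℚ, F q ≠ s) {N : ℕ → ℕ} (hN : Tendsto N atTop atTop) :
    Tendsto (fun k => Qf F ((⌊(N k : ℝ) * s⌋₊ + 1 / 2) / N k)) atTop (𝓝 (Qf F s)) := by
  have hNr : Tendsto (fun k => (N k : ℝ)) atTop atTop := tendsto_natCast_atTop_atTop.comp hN
  have hlim : Tendsto (fun k => ((⌊(N k : ℝ) * s⌋₊ : ℝ) + 1 / 2) / N k) atTop (𝓝 s) := by
    have ha : Tendsto (fun k => (⌊s * (N k : ℝ)⌋₊ : ℝ) / N k) atTop (𝓝 s) :=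
      (tendsto_nat_floor_mul_div_atTop hs.1.le).comp hNr
    have hb : Tendsto (fun k => (1 / 2 : ℝ) / N k) atTop (𝓝 0) := hNr.const_div_atTop _
    have := ha.add hb
    rw [add_zero] at this
    refine this.congr fun k => ?_
    rw [mul_comm, add_div]
  have hmem := hlim.eventually (Ioo_mem_nhds hs.1 hs.2)
  refine Qf_conv hF h0 h1 hs hsF dense_univ _ ?_ ?_
  · intro x _ hx
    filter_upwards [hlim.eventually (gt_mem_nhds hx), hmem] with k hk hm
    refine csInf_le ?_ hk.le
    obtain ⟨z, hz⟩ := (h0.eventually (gt_mem_nhds hm.1)).exists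
    refine ⟨z, fun y hy => ?_⟩
    by_contra hc
    exact absurd (le_trans hy (hF (not_le.1 hc).le)) (not_le.2 hz)
  · intro x _ hx
    filter_upwards [hlim.eventually (lt_mem_nhds hx), hmem] with k hk hm
    refine le_csInf ?_ ?_
    · obtain ⟨z, hz⟩ := (h1.eventually (lt_mem_nhds hm.2)).exists
      exact ⟨z, hz.le⟩
    · intro y hy
      by_contra hc
      exact absurd (lt_of_lt_of_le hk (le_trans hy (hF (not_le.1 hc).le))) (lt_irrefl _)

/-- extension of a finite weight vector to ℕ -/
def extW {n : ℕ} (w : Fin n → ℝ) (i : ℕ) : ℝ := if h : i < n then w ⟨i, h⟩ else 0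

lemma sorted_count {n : ℕ} {w : Fin n → ℝ} (hw : Monotone w) (x : ℝ) (i : Fin n) :
    (w i ≤ x → (i : ℝ) + 1 ≤ ∑ j : Fin n, indic (w j ≤ x)) ∧
    (x < w i → ∑ j : Fin n, indic (w j ≤ x) ≤ i) := by
  classical
  have hs : ∑ j : Fin n, indic (w j ≤ x) = ((Finset.univ.filter fun j => w j ≤ x).card : ℝ) := by
    simp [indic]
  rw [hs]
  constructor
  · intro hi
    have : Finset.Iic i ⊆ Finset.univ.filter fun j => w j ≤ x := by
      intro j hj
      simp only [Finset.mem_filter, Finset.mem_univ, true_and]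
      exact (hw (Finset.mem_Iic.1 hj)).trans hi
    have := Finset.card_le_card this
    rw [Fin.card_Iic] at this
    exact_mod_cast this
  · intro hi
    have : (Finset.univ.filter fun j => w j ≤ x) ⊆ Finset.Iio i := by
      intro j hj
      simp only [Finset.mem_filter, Finset.mem_univ, true_and] at hj
      rw [Finset.mem_Iio]
      by_contra hc
      exact absurd (hi.trans_le (hw (not_lt.1 hc))) (not_lt.2 hj)
    have := Finset.card_le_card this
    rw [Fin.card_Iio] at this
    exact_mod_cast this

lemma sorted_conv {F : ℝ → ℝ} (hF : Monotone F) (h0 : Tendsto F atBot (𝓝 0))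
    (h1 : Tendsto F atTop (𝓝 1)) {s : ℝ} (hs : s ∈ Set.Ioo (0 : ℝ) 1)
    (hsF : ∀ q : ℚ, F q ≠ s) {N : ℕ → ℕ} (hN : Tendsto N atTop atTop)
    {D : Set ℝ} (hD : Dense D) (w : ∀ k, Fin (N k) → ℝ) (hw : ∀ k, Monotone (w k))
    (hc : ∀ x ∈ D, Tendsto (fun k => (∑ i : Fin (N k), indic (w k i ≤ x)) / N k) atTop (𝓝 (F x))) :
    Tendsto (fun k => extW (w k) ⌊(N k : ℝ) * s⌋₊) atTop (𝓝 (Qf F s)) := by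
  have hpos : ∀ᶠ k in atTop, 0 < N k := hN.eventually (eventually_gt_atTop 0)
  have hlt : ∀ k, 0 < N k → ⌊(N k : ℝ) * s⌋₊ < N k := by
    intro k hk
    have hk' : (0 : ℝ) < N k := by exact_mod_cast hk
    rw [Nat.floor_lt (by nlinarith [hs.1])]
    nlinarith [hs.2]
  refine Qf_conv hF h0 h1 hs hsF hD _ ?_ ?_
  · intro x hxD hx
    filter_upwards [hpos, (hc x hxD).eventually (lt_mem_nhds hx)] with k hk hk2
    have hk' : (0 : ℝ) < N k := by exact_mod_cast hk
    rw [extW, dif_pos (hlt k hk)]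
    by_contra hcon
    have h3 := (sorted_count (hw k) x ⟨_, hlt k hk⟩).2 (not_le.1 hcon)
    rw [lt_div_iff₀ hk'] at hk2
    have h4 := Nat.floor_le (a := (N k : ℝ) * s) (by nlinarith [hs.1])
    simp only at h3
    linarith
  · intro x hxD hx
    filter_upwards [hpos, (hc x hxD).eventually (gt_mem_nhds hx)] with k hk hk2
    have hk' : (0 : ℝ) < N k := by exact_mod_cast hk
    rw [extW, dif_pos (hlt k hk)]
    by_contra hcon
    have h3 := (sorted_count (hw k) x ⟨_, hlt k hk⟩).1 (not_le.1 hcon).le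
    rw [div_lt_iff₀ hk'] at hk2
    have h4 := Nat.lt_floor_add_one ((N k : ℝ) * s)
    simp only at h3
    linarith

lemma ext_tendsto {N : ℕ → ℕ} (hN : StrictMono N) {a : ℕ → ℝ} {x : ℝ}
    (ha : Tendsto a atTop (𝓝 x)) :
    Tendsto (Function.extend N a (fun _ => x)) atTop (𝓝 x) := by
  intro U hU
  have h1 := ha hU
  rw [mem_map, mem_atTop_sets] at h1
  obtain ⟨k0, hk0⟩ := h1
  rw [mem_map, mem_atTop_sets]
  refine ⟨N k0, fun n hn => ?_⟩
  show Function.extend N a (fun _ => x) n ∈ U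
  by_cases hr : ∃ k, N k = n
  · obtain ⟨k, rfl⟩ := hr
    rw [hN.injective.extend_apply]
    exact hk0 k (hN.le_iff_le.1 hn)
  · rw [Function.extend_apply' _ _ _ hr]
    exact mem_of_mem_nhds hU

lemma kconv {d : ℕ} {Ω : Type} [MeasurableSpace Ω] {M : SIRGModel d Ω}
    (A : SIRGWeakAssumptions M) {N : ℕ → ℕ} (hN : StrictMono N) {a b : ℕ → ℝ} {x y : ℝ}
    (ha : Tendsto a atTop (𝓝 x)) (hb : Tendsto b atTop (𝓝 y)) :
    ∀ᵐ t ∂(volume : Measure ℝ), 0 < t →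
      Tendsto (fun k => M.κn (N k) t (a k) (b k)) atTop (𝓝 (A.κ t x y)) := by
  filter_upwards [A.κ_conv x y _ _ (ext_tendsto hN ha) (ext_tendsto hN hb)] with t ht ht0
  refine ((ht ht0).comp hN.tendsto_atTop).congr fun k => ?_
  simp [hN.injective.extend_apply]

lemma psi_tendsto {d : ℕ} (hd : 1 ≤ d) (r : ℝ) {Ω : Type} [MeasurableSpace Ω] {M : SIRGModel d Ω}
    (A : SIRGWeakAssumptions M) {N : ℕ → ℕ} (hN : StrictMono N) {a b a' b' : ℕ → ℝ} {x y : ℝ}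
    (ha : Tendsto a atTop (𝓝 x)) (hb : Tendsto b atTop (𝓝 y))
    (ha' : Tendsto a' atTop (𝓝 x)) (hb' : Tendsto b' atTop (𝓝 y)) :
    Tendsto (fun k => psiF d r (M.κn (N k)) (a k) (b k) (a' k) (b' k)) atTop (𝓝 0) := by
  have hm : ∀ k (a b : ℝ), Measurable fun z : Euc d => M.κn (N k) ‖z‖ a b := fun k a b =>
    (M.κn_meas (N k)).comp (f := fun z : Euc d => (‖z‖, a, b)) (by fun_prop)
  have := tendsto_lintegral_of_dominated_convergence
    (μ := volume.restrict (Metric.ball (0 : Euc d) (2 * r)))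
    (F := fun k z => ENNReal.ofReal (min 1 |M.κn (N k) ‖z‖ (a k) (b k) -
      M.κn (N k) ‖z‖ (a' k) (b' k)|)) (f := fun _ => 0) (fun _ => 1)
    (fun k => (measurable_const.min
      (measurable_norm.comp ((hm k _ _).sub (hm k _ _)))).ennreal_ofReal)
    (fun k => Eventually.of_forall fun z => by
      rw [ENNReal.ofReal_le_one]; exact min_le_left _ _)
    (by simp [measure_ball_lt_top.ne])
    (by
      have h1 := ae_norm hd (kconv A hN ha hb)
      have h2 := ae_norm hd (kconv A hN ha' hb')
      filter_upwards [ae_restrict_of_ae h1, ae_restrict_of_ae h2] with z hz1 hz2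
      have h3 := (hz1.sub hz2).abs
      have h4 := (tendsto_const_nhds (x := (1 : ℝ))).min h3
      have h5 := ENNReal.tendsto_ofReal h4
      simpa using h5)
  simpa [psiF] using this

lemma psi_le (d : ℕ) (r : ℝ) (k : ℝ → ℝ → ℝ → ℝ) (a b a' b' : ℝ) :
    psiF d r k a b a' b' ≤ volume (Metric.ball (0 : Euc d) (2 * r)) := by
  unfold psiF
  calc _ ≤ ∫⁻ z in Metric.ball (0 : Euc d) (2 * r), 1 := by
        gcongr with z
        rw [ENNReal.ofReal_le_one]; exact min_le_left _ _
    _ = _ := by simp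

def wtQ (F : ℝ → ℝ) (n : ℕ) (i : ℕ) : ℝ := Qf F ((i + 1 / 2) / n)

lemma core {d : ℕ} (hd : 1 ≤ d) (r : ℝ) {Ω : Type} [MeasurableSpace Ω] {M : SIRGModel d Ω}
    (A : SIRGWeakAssumptions M) {N : ℕ → ℕ} (hN : StrictMono N)
    {F : ℝ → ℝ} (hF : Monotone F) (h0 : Tendsto F atBot (𝓝 0))
    (h1 : Tendsto F atTop (𝓝 1))
    {D : Set ℝ} (hD : Dense D) (w : ∀ k, Fin (N k) → ℝ) (hw : ∀ k, Monotone (w k))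
    (hc : ∀ x ∈ D, Tendsto (fun k => (∑ i : Fin (N k), indic (w k i ≤ x)) / N k) atTop (𝓝 (F x))) :
    Tendsto (fun k => (N k : ℝ≥0∞)⁻¹ * ((N k : ℝ≥0∞)⁻¹ * ∑ i, ∑ j,
      psiF d r (M.κn (N k)) (w k i) (w k j) (wtQ F (N k) i) (wtQ F (N k) j))) atTop (𝓝 0) := by
  set g : ℕ → ℕ → ℕ → ℝ≥0∞ := fun k i j => psiF d r (M.κn (N k)) (extW (w k) i) (extW (w k) j)
    (wtQ F (N k) i) (wtQ F (N k) j) with hg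
  have hgle : ∀ k i j, g k i j ≤ volume (Metric.ball (0 : Euc d) (2 * r)) :=
    fun k i j => psi_le _ _ _ _ _ _ _
  have hgood : ∀ᵐ s ∂unif01, s ∈ Set.Ioo (0 : ℝ) 1 ∧ ∀ q : ℚ, F q ≠ s := by
    have hcount : ∀ᵐ s ∂(volume : Measure ℝ), s ∉ Set.range (fun q : ℚ => F q) ∪ {0, 1} :=
      ((Set.countable_range _).union (by simp)).ae_notMem _
    unfold unif01
    filter_upwards [ae_restrict_of_ae hcount, ae_restrict_mem measurableSet_Icc] with s hs hs2
    simp only [Set.mem_union, Set.mem_range, Set.mem_insert_iff, Set.mem_singleton_iff,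
      not_or, not_exists] at hs
    exact ⟨⟨lt_of_le_of_ne hs2.1 (Ne.symm hs.2.1), lt_of_le_of_ne hs2.2 hs.2.2⟩, hs.1⟩
  have hfl : ∀ k, Measurable fun s : ℝ => ⌊(N k : ℝ) * s⌋₊ := fun k =>
    Nat.measurable_floor.comp (measurable_const.mul measurable_id)
  have hlim : Tendsto (fun k => ∫⁻ s, ∫⁻ s', g k ⌊(N k : ℝ) * s⌋₊ ⌊(N k : ℝ) * s'⌋₊ ∂unif01 ∂unif01)
      atTop (𝓝 0) := by
    have := tendsto_lintegral_of_dominated_convergence (μ := unif01)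
      (F := fun k s => ∫⁻ s', g k ⌊(N k : ℝ) * s⌋₊ ⌊(N k : ℝ) * s'⌋₊ ∂unif01) (f := fun _ => 0)
      (fun _ => volume (Metric.ball (0 : Euc d) (2 * r)))
      (fun k => (measurable_from_nat (f := fun i => ∫⁻ s', g k i ⌊(N k : ℝ) * s'⌋₊ ∂unif01)).comp
        (hfl k))
      (fun k => Eventually.of_forall fun s => by
        calc _ ≤ ∫⁻ s', volume (Metric.ball (0 : Euc d) (2 * r)) ∂unif01 :=
              lintegral_mono fun s' => hgle _ _ _
          _ = _ := by simp)
      (by simp [measure_ball_lt_top.ne])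
      (by
        filter_upwards [hgood] with s hs
        have := tendsto_lintegral_of_dominated_convergence (μ := unif01)
          (F := fun k s' => g k ⌊(N k : ℝ) * s⌋₊ ⌊(N k : ℝ) * s'⌋₊) (f := fun _ => 0)
          (fun _ => volume (Metric.ball (0 : Euc d) (2 * r)))
          (fun k => (measurable_from_nat (f := fun j => g k ⌊(N k : ℝ) * s⌋₊ j)).comp (hfl k))
          (fun k => Eventually.of_forall fun s => hgle _ _ _)
          (by simp [measure_ball_lt_top.ne])
          (by
            filter_upwards [hgood] with s' hs'
            exact psi_tendsto hd r A hN
              (sorted_conv hF h0 h1 hs.1 hs.2 hN.tendsto_atTop hD w hw hc)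
              (sorted_conv hF h0 h1 hs'.1 hs'.2 hN.tendsto_atTop hD w hw hc)
              (grid_conv hF h0 h1 hs.1 hs.2 hN.tendsto_atTop)
              (grid_conv hF h0 h1 hs'.1 hs'.2 hN.tendsto_atTop))
        simpa using this)
    simpa using this
  refine tendsto_of_tendsto_of_tendsto_of_le_of_le' tendsto_const_nhds hlim
    (Eventually.of_forall fun _ => bot_le) ?_
  filter_upwards [hN.tendsto_atTop.eventually (eventually_gt_atTop 0)] with k hk
  have hext : ∀ i : Fin (N k), extW (w k) i = w k i := fun i => by simp [extW]
  calc _ = (N k : ℝ≥0∞)⁻¹ * ∑ i : Fin (N k), (N k : ℝ≥0∞)⁻¹ * ∑ j : Fin (N k), g k i j := by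
        simp only [hg, hext, Finset.mul_sum]
    _ ≤ (N k : ℝ≥0∞)⁻¹ * ∑ i : Fin (N k), ∫⁻ s', g k i ⌊(N k : ℝ) * s'⌋₊ ∂unif01 := by
        gcongr with i _
        exact step_sum hk (g k i)
    _ ≤ _ := step_sum hk (fun i => ∫⁻ s', g k i ⌊(N k : ℝ) * s'⌋₊ ∂unif01)

/-- Deterministic convergence of the conditional means (unsorted version). -/
lemma fmean_conv {d : ℕ} (hd : 1 ≤ d) {r : ℝ} (hr : 0 < r) {Ω : Type} [MeasurableSpace Ω]
    {M : SIRGModel d Ω}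
    (A : SIRGWeakAssumptions M) {V : Type} [Fintype V] (H : SimpleGraph V) (h : V)
    {N : ℕ → ℕ} (hN : StrictMono N)
    {F : ℝ → ℝ} (hF : Monotone F) (h0 : Tendsto F atBot (𝓝 0))
    (h1 : Tendsto F atTop (𝓝 1))
    {D : Set ℝ} (hD : Dense D) (w : ∀ k, Fin (N k) → ℝ)
    (hc : ∀ x ∈ D, Tendsto (fun k => (∑ i : Fin (N k), indic (w k i ≤ x)) / N k) atTop (𝓝 (F x))) :
    Tendsto (fun k => fmean d r H h (M.κn (N k)) (w k) -
      fmean d r H h (M.κn (N k)) (fun i : Fin (N k) => wtQ F (N k) i)) atTop (𝓝 0) := by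
  classical
  obtain ⟨K, hK⟩ := packing d r hr (Fintype.card V)
  set w' : ∀ k, Fin (N k) → ℝ := fun k i => w k (Tuple.sort (w k) i) with hw'
  have hc' : ∀ x ∈ D, Tendsto (fun k => (∑ i : Fin (N k), indic (w' k i ≤ x)) / N k)
      atTop (𝓝 (F x)) := by
    intro x hx
    refine (hc x hx).congr fun k => ?_
    congr 1
    exact (Equiv.sum_comp (Tuple.sort (w k)) (fun i => indic (w k i ≤ x))).symm
  have hco := core hd r A hN hF h0 h1 hD w' (fun k => Tuple.monotone_sort (w k)) hc'
  have hco2 := ENNReal.Tendsto.const_mul hco (a := (K : ℝ≥0∞)) (Or.inr (by simp))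
  rw [mul_zero] at hco2
  have hE : Tendsto (fun k => ENNReal.ofReal |fmean d r H h (M.κn (N k)) (w k) -
      fmean d r H h (M.κn (N k)) (fun i : Fin (N k) => wtQ F (N k) i)|) atTop (𝓝 0) := by
    refine tendsto_of_tendsto_of_tendsto_of_le_of_le' tendsto_const_nhds hco2
      (Eventually.of_forall fun _ => bot_le) ?_
    filter_upwards [hN.tendsto_atTop.eventually (eventually_gt_atTop 0)] with k hk
    haveI := unifBox_prob hd hk
    have hp := fmean_perm (d := d) r H h (M.κn (N k)) (M.κn_symm _) (w k) (Tuple.sort (w k))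
    rw [← hp]
    exact fmean_diff hk hK H h _ (M.κn_meas _) _ _
  have := (ENNReal.tendsto_toReal ENNReal.zero_ne_top).comp hE
  rw [tendsto_zero_iff_abs_tendsto_zero]
  refine this.congr fun k => ?_
  simp [ENNReal.toReal_ofReal]

lemma emp_prod {d : ℕ} {Ω : Type} [MeasurableSpace Ω] {M : SIRGModel d Ω}
    (A : SIRGWeakAssumptions M) :
    TendstoInMeasure (M.P.prod (gaussianReal 0 1))
      (fun n (q : Ω × ℝ) => (∑ i : Fin n, indic (M.Wt n i q.1 ≤ q.2)) / n) atTop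
      (fun q => (A.μW (Set.Iic q.2)).toReal) := by
  have := A.probμW
  have hFm : Monotone fun x : ℝ => (A.μW (Set.Iic x)).toReal := fun x y hxy =>
    ENNReal.toReal_mono (measure_ne_top _ _) (measure_mono (Set.Iic_subset_Iic.2 hxy))
  intro ε hε
  have hm1 : ∀ n, Measurable fun q : Ω × ℝ => (∑ i : Fin n, indic (M.Wt n i q.1 ≤ q.2)) / (n : ℝ) := by
    intro n
    refine Measurable.div_const (Finset.measurable_fun_sum _ fun i _ => ?_) _
    unfold indic
    exact Measurable.ite (measurableSet_le ((M.Wt_meas n i).comp measurable_fst) measurable_snd)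
      measurable_const measurable_const
  have hms : ∀ n, MeasurableSet {q : Ω × ℝ | ε ≤ edist
      ((∑ i : Fin n, indic (M.Wt n i q.1 ≤ q.2)) / (n : ℝ)) (A.μW (Set.Iic q.2)).toReal} := by
    intro n
    exact measurableSet_le measurable_const
      ((hm1 n).edist (hFm.measurable.comp measurable_snd))
  simp_rw [Measure.prod_apply_symm (hms _)]
  have := tendsto_lintegral_of_dominated_convergence (μ := gaussianReal 0 1)
    (F := fun n x => M.P ((fun ω => (ω, x)) ⁻¹' {q : Ω × ℝ | ε ≤ edist
      ((∑ i : Fin n, indic (M.Wt n i q.1 ≤ q.2)) / (n : ℝ)) (A.μW (Set.Iic q.2)).toReal}))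
    (f := fun _ => 0) (fun _ => 1)
    (fun n => measurable_measure_prodMk_right (hms n))
    (fun n => Eventually.of_forall fun x => prob_le_one)
    (by simp)
    (by
      have hc : {x : ℝ | 0 < A.μW {x}}.Countable :=
        Measure.countable_meas_pos_of_disjoint_iUnion (fun x => measurableSet_singleton x)
          (fun x y hxy => by simpa [Function.onFun] using hxy)
      have h1 : ∀ᵐ x ∂(volume : Measure ℝ), x ∉ {x : ℝ | 0 < A.μW {x}} := hc.ae_notMem _
      have h2 := (gaussianReal_absolutelyContinuous 0 one_ne_zero).ae_le h1
      filter_upwards [h2] with x hx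
      exact A.weights_conv x (not_lt.1 hx |>.antisymm bot_le) ε hε)
  simpa using this

lemma emp_subseq {d : ℕ} {Ω : Type} [MeasurableSpace Ω] {M : SIRGModel d Ω}
    (A : SIRGWeakAssumptions M) {ns : ℕ → ℕ} (hns : StrictMono ns) :
    ∃ ms : ℕ → ℕ, StrictMono ms ∧ ∀ᵐ ω ∂M.P, ∃ D : Set ℝ, Dense D ∧ ∀ x ∈ D,
      Tendsto (fun k => (∑ i : Fin (ns (ms k)), indic (M.Wt (ns (ms k)) i ω ≤ x)) / (ns (ms k) : ℕ))
        atTop (𝓝 (A.μW (Set.Iic x)).toReal) := by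
  have h1 : TendstoInMeasure (M.P.prod (gaussianReal 0 1))
      (fun k (q : Ω × ℝ) => (∑ i : Fin (ns k), indic (M.Wt (ns k) i q.1 ≤ q.2)) / (ns k : ℝ)) atTop
      (fun q => (A.μW (Set.Iic q.2)).toReal) :=
    fun ε hε => (emp_prod A ε hε).comp hns.tendsto_atTop
  obtain ⟨ms, hms, hae⟩ := h1.exists_seq_tendsto_ae
  refine ⟨ms, hms, ?_⟩
  filter_upwards [Measure.ae_ae_of_ae_prod hae] with ω hω
  refine ⟨_, Measure.dense_of_ae
    ((gaussianReal_absolutelyContinuous' 0 one_ne_zero).ae_le hω), fun x hx => hx⟩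

lemma fmean_meas {d n : ℕ} [SigmaFinite (unifBox d n)] (r : ℝ) {V : Type} (H : SimpleGraph V) (h : V)
    (k : ℝ → ℝ → ℝ → ℝ) (hk : Measurable fun p : ℝ × ℝ × ℝ => k p.1 p.2.1 p.2.2) :
    Measurable fun w : Fin n → ℝ => fmean d r H h k w := by
  have h1 : Measurable fun q : ((Fin n → ℝ) × (Fin n → Euc d)) × (Prs n → ℝ) =>
      Cf (nearR r q.1.2) (edg k q.1.1 q.1.2 q.2) H h :=
    (Cf_meas3 r H h k hk).comp
      (f := fun q : ((Fin n → ℝ) × (Fin n → Euc d)) × (Prs n → ℝ) => (q.1.2, q.1.1, q.2))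
      (by fun_prop)
  have h2 := (h1.stronglyMeasurable.integral_prod_right'
    (ν := Measure.pi fun _ : Prs n => unif01))
  exact (h2.integral_prod_right' (ν := Measure.pi fun _ : Fin n => unifBox d n)).measurable

lemma fmean_abs {d n : ℕ} [IsProbabilityMeasure (unifBox d n)] (r : ℝ) {V : Type}
    (H : SimpleGraph V) (h : V) (k : ℝ → ℝ → ℝ → ℝ) (w : Fin n → ℝ) :
    |fmean d r H h k w| ≤ 1 :=
  abs_int_le fun _ => abs_int_le fun _ => Cf_abs _ _ _ _

def Fc (μ : Measure ℝ) (x : ℝ) : ℝ := (μ (Set.Iic x)).toReal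

lemma fmean_sq {d : ℕ} (hd : 1 ≤ d) {r : ℝ} (hr : 0 < r) {Ω : Type} [MeasurableSpace Ω]
    {M : SIRGModel d Ω}
    (A : SIRGWeakAssumptions M) {V : Type} [Fintype V] (H : SimpleGraph V) (h : V) :
    Tendsto (fun n => ∫ ω, (fmean d r H h (M.κn n) (fun i => M.Wt n i ω) -
      fmean d r H h (M.κn n) (fun i : Fin n => wtQ (Fc A.μW) n i)) ^ 2 ∂M.P) atTop (𝓝 0) := by
  have := A.probμW
  have hFm : Monotone (Fc A.μW) := fun x y hxy =>
    ENNReal.toReal_mono (measure_ne_top _ _) (measure_mono (Set.Iic_subset_Iic.2 hxy))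
  have hcdf : Fc A.μW = fun x => cdf A.μW x := by
    ext x; rw [cdf_eq_real]; rfl
  have h0 : Tendsto (Fc A.μW) atBot (𝓝 0) := by rw [hcdf]; exact tendsto_cdf_atBot _
  have h1 : Tendsto (Fc A.μW) atTop (𝓝 1) := by rw [hcdf]; exact tendsto_cdf_atTop _
  refine tendsto_of_subseq_tendsto fun ns hns => ?_
  obtain ⟨φ, hφ, hφ2⟩ := strictMono_subseq_of_tendsto_atTop hns
  obtain ⟨ms, hms, hae⟩ := emp_subseq A hφ2
  refine ⟨φ ∘ ms, ?_⟩
  set N : ℕ → ℕ := fun k => ns (φ (ms k)) with hNdef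
  have hN : StrictMono N := hφ2.comp hms
  show Tendsto (fun k => ∫ ω, (fmean d r H h (M.κn (N k)) (fun i => M.Wt (N k) i ω) -
      fmean d r H h (M.κn (N k)) (fun i : Fin (N k) => wtQ (Fc A.μW) (N k) i)) ^ 2 ∂M.P) atTop (𝓝 0)
  have hpos : ∀ᶠ k in atTop, 0 < N k := hN.tendsto_atTop.eventually (eventually_gt_atTop 0)
  have := tendsto_integral_filter_of_dominated_convergence (μ := M.P) (l := atTop)
    (F := fun k ω => (fmean d r H h (M.κn (N k)) (fun i => M.Wt (N k) i ω) -
      fmean d r H h (M.κn (N k)) (fun i : Fin (N k) => wtQ (Fc A.μW) (N k) i)) ^ 2)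
    (f := fun _ => 0) (fun _ => 4)
    (by
      filter_upwards [hpos] with k hk
      have := unifBox_prob hd hk
      refine Measurable.aestronglyMeasurable ?_
      refine (Measurable.sub_const ((fmean_meas r H h _ (M.κn_meas _)).comp
        (measurable_pi_lambda _ fun i => M.Wt_meas (N k) i)) _).pow_const _)
    (by
      filter_upwards [hpos] with k hk
      have := unifBox_prob hd hk
      filter_upwards with ω
      have a1 := abs_le.1 (fmean_abs (d := d) r H h (M.κn (N k)) (fun i => M.Wt (N k) i ω))
      have a2 := abs_le.1 (fmean_abs (d := d) r H h (M.κn (N k))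
        (fun i : Fin (N k) => wtQ (Fc A.μW) (N k) i))
      rw [Real.norm_eq_abs, abs_of_nonneg (sq_nonneg _)]
      nlinarith)
    (integrable_const _)
    (by
      filter_upwards [hae] with ω hω
      obtain ⟨D, hD, hc⟩ := hω
      have := (fmean_conv hd hr A H h hN hFm h0 h1 hD (fun k i => M.Wt (N k) i ω) hc).pow 2
      simpa using this)
  simpa using this

lemma freq_eq {d : ℕ} {Ω : Type} [MeasurableSpace Ω] (M : SIRGModel d Ω) (n : ℕ) (r : ℝ)
    {V : Type} (H : SimpleGraph V) (h : V) (ω : Ω) :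
    M.empNbhdFreq n r H h ω = Cf (nearR r fun i => M.Y n i ω)
      (edg (M.κn n) (fun i => M.Wt n i ω) (fun i => M.Y n i ω)
        (fun p : Prs n => M.U n p.1.1 p.1.2 ω)) H h := by
  unfold SIRGModel.empNbhdFreq Cf
  have hg : M.graph n ω = gphF (edg (M.κn n) (fun i => M.Wt n i ω) (fun i => M.Y n i ω)
        (fun p : Prs n => M.U n p.1.1 p.1.2 ω)) := by
    unfold SIRGModel.graph gphF edg
    congr 1
    ext i j
    simp
  congr 1
  refine Finset.sum_congr rfl fun i _ => ?_
  congr 1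
  unfold SIRGModel.euclNbhdIso nbF SIRGModel.euclNbhd
  rw [hg]
  rfl

open Classical in
lemma var_n {d n : ℕ} (hd : 1 ≤ d) (hn : 0 < n) {r : ℝ} {Ω : Type} [MeasurableSpace Ω]
    (M : SIRGModel d Ω) {V : Type} [Fintype V] {K : ℕ}
    (hK : ∀ (n : ℕ) (y : Fin n → Euc d) (x : Euc d),
    (Finset.univ.filter fun i => dist (y i) x < r ∧
      (Finset.univ.filter fun j => nearR r y j i).card = Fintype.card V).card ≤ K)
    (H : SimpleGraph V) (h : V) (a : ℝ) :
    variance (M.empNbhdFreq n r H h) M.P ≤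
      (K ^ 2 * volume.real (Metric.ball (0 : Euc d) (2 * r)) + (1 + 4 * K) ^ 2) / n +
      ∫ ω, (fmean d r H h (M.κn n) (fun i => M.Wt n i ω) - a) ^ 2 ∂M.P := by
  have := unifBox_prob hd hn
  set T : Ω → (Fin n → Euc d) × (Fin n → ℝ) × (Prs n → ℝ) := fun ω =>
    ((fun i => M.Y n i ω), (fun i => M.Wt n i ω), (fun p : Prs n => M.U n p.1.1 p.1.2 ω)) with hT
  have hTm : Measurable T := by
    refine Measurable.prodMk (measurable_pi_lambda _ fun i => M.Y_meas n i)
      (Measurable.prodMk (measurable_pi_lambda _ fun i => M.Wt_meas n i)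
        (measurable_pi_lambda _ fun p => M.U_meas n _ _))
  have hWm : Measurable fun ω i => M.Wt n i ω := measurable_pi_lambda _ fun i => M.Wt_meas n i
  set G : (Fin n → Euc d) × (Fin n → ℝ) × (Prs n → ℝ) → ℝ := fun q =>
    Cf (nearR r q.1) (edg (M.κn n) q.2.1 q.1 q.2.2) H h with hG
  have hGm : Measurable G := Cf_meas3 r H h _ (M.κn_meas n)
  have hfe : M.empNbhdFreq n r H h = fun ω => G (T ω) := by
    ext ω; exact freq_eq M n r H h ω
  have hfm : Measurable (M.empNbhdFreq n r H h) := by rw [hfe]; exact hGm.comp hTm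
  have hGa : ∀ q, |G q| ≤ 1 := fun q => Cf_abs _ _ _ _
  have hG2 : Measurable fun q => (G q - a) ^ 2 := (hGm.sub_const _).pow_const _
  have hG2b : ∀ q, |(G q - a) ^ 2| ≤ (1 + |a|) ^ 2 := by
    intro q
    rw [abs_pow]
    gcongr
    exact (abs_sub _ _).trans (by gcongr; exact hGa q)
  set νW := Measure.map (fun ω i => M.Wt n i ω) M.P with hνW
  have : IsProbabilityMeasure νW := Measure.isProbabilityMeasure_map hWm.aemeasurable
  set νU := Measure.pi fun _ : Prs n => unif01 with hνU
  set νY := Measure.pi fun _ : Fin n => unifBox d n with hνY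
  have e1 : variance (M.empNbhdFreq n r H h) M.P ≤ ∫ ω, (G (T ω) - a) ^ 2 ∂M.P := by
    rw [variance_eq_integral hfm.aemeasurable]
    have := bd_sq_dec (μ := M.P) (f := M.empNbhdFreq n r H h) hfm (B := 1)
      (fun ω => by rw [hfe]; exact hGa _) a
    have h2 : ∫ ω, (G (T ω) - a) ^ 2 ∂M.P = ∫ ω, (M.empNbhdFreq n r H h ω - a) ^ 2 ∂M.P := by
      rw [hfe]
    rw [h2, this]
    have := sq_nonneg (∫ z, M.empNbhdFreq n r H h z ∂M.P - a)
    linarith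
  refine e1.trans ?_
  have hjl : Measure.map T M.P = νY.prod (νW.prod νU) := M.joint_law n
  have e2 : ∫ ω, (G (T ω) - a) ^ 2 ∂M.P = ∫ q, (G q - a) ^ 2 ∂(νY.prod (νW.prod νU)) := by
    rw [← hjl, integral_map hTm.aemeasurable hG2.aestronglyMeasurable]
  have e3 : ∫ q, (G q - a) ^ 2 ∂(νY.prod (νW.prod νU)) =
      ∫ y, ∫ w, ∫ u, (G (y, w, u) - a) ^ 2 ∂νU ∂νW ∂νY := by
    rw [integral_prod _ (bd_integrable hG2 hG2b)]
    congr 1; ext y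
    rw [integral_prod]
    exact bd_integrable (hG2.comp (f := fun p : (Fin n → ℝ) × (Prs n → ℝ) => (y, p))
      (by fun_prop)) (fun p => hG2b _)
  have hinner : Measurable fun p : (Fin n → Euc d) × (Fin n → ℝ) =>
      ∫ u, (G (p.1, p.2, u) - a) ^ 2 ∂νU := by
    have h1 : Measurable fun q : ((Fin n → Euc d) × (Fin n → ℝ)) × (Prs n → ℝ) =>
        (G (q.1.1, q.1.2, q.2) - a) ^ 2 :=
      hG2.comp (f := fun q : ((Fin n → Euc d) × (Fin n → ℝ)) × (Prs n → ℝ) =>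
        (q.1.1, q.1.2, q.2)) (by fun_prop)
    exact (h1.stronglyMeasurable.integral_prod_right' (ν := νU)).measurable
  have hinnerb : ∀ p : (Fin n → Euc d) × (Fin n → ℝ),
      |∫ u, (G (p.1, p.2, u) - a) ^ 2 ∂νU| ≤ (1 + |a|) ^ 2 := fun p =>
    abs_int_le fun u => hG2b _
  have e4 : ∫ y, ∫ w, ∫ u, (G (y, w, u) - a) ^ 2 ∂νU ∂νW ∂νY =
      ∫ w, ∫ y, ∫ u, (G (y, w, u) - a) ^ 2 ∂νU ∂νY ∂νW :=
    integral_integral_swap (f := fun y w => ∫ u, (G (y, w, u) - a) ^ 2 ∂νU)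
      (bd_integrable hinner hinnerb)
  rw [e2, e3, e4]
  have hfmm : Measurable fun w : Fin n → ℝ => (fmean d r H h (M.κn n) w - a) ^ 2 :=
    ((fmean_meas r H h _ (M.κn_meas n)).sub_const _).pow_const _
  have hfmi : Integrable (fun w : Fin n → ℝ => (fmean d r H h (M.κn n) w - a) ^ 2) νW := by
    refine bd_integrable (B := (1 + |a|) ^ 2) hfmm fun w => ?_
    rw [abs_pow]
    gcongr
    exact (abs_sub _ _).trans (by gcongr; exact fmean_abs _ _ _ _ _)
  have e5 : ∫ ω, (fmean d r H h (M.κn n) (fun i => M.Wt n i ω) - a) ^ 2 ∂M.P =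
      ∫ w, (fmean d r H h (M.κn n) w - a) ^ 2 ∂νW := by
    rw [hνW, integral_map hWm.aemeasurable hfmm.aestronglyMeasurable]
  rw [e5]
  set C := (K ^ 2 * volume.real (Metric.ball (0 : Euc d) (2 * r)) + (1 + 4 * K : ℝ) ^ 2) / n with hC
  have e6 : C + ∫ w, (fmean d r H h (M.κn n) w - a) ^ 2 ∂νW =
      ∫ w, (C + (fmean d r H h (M.κn n) w - a) ^ 2) ∂νW := by
    rw [integral_add (integrable_const _) hfmi]; simp
  rw [e6]
  refine integral_mono ?_ ((integrable_const _).add hfmi) fun w => ?_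
  · refine bd_integrable (B := (1 + |a|) ^ 2) ?_ fun w => abs_int_le fun y => hinnerb (y, w)
    exact (hinner.stronglyMeasurable.integral_prod_left' (μ := νY)).measurable
  · exact var_bound hn hK H h (M.κn n) (M.κn_meas n) w a

/-- Lemma: concentration of the empirical Euclidean graph neighbourhood
measure. Under Assumptions (A1)–(A3), for every `r > 0` and every finite rooted graph
`(H, h)`, the variance of `C_{r,n}(H,h) = (1/n) Σ_{i=1}^n 1{F^{𝔾_n}_i(r) ≅ (H,h)}`
converges to `0` as `n → ∞`. -/
theorem stmt2 {d : ℕ} (hd : 1 ≤ d) {Ω : Type} [MeasurableSpace Ω]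
    (M : SIRGModel d Ω) (A : SIRGAssumptions M)
    (r : ℝ) (hr : 0 < r) {V : Type} [Fintype V] (H : SimpleGraph V) (h : V) :
    Tendsto (fun n : ℕ => variance (M.empNbhdFreq n r H h) M.P) atTop (𝓝 0) := by
  classical
  obtain ⟨K, hK⟩ := packing d r hr (Fintype.card V)
  have h1 := fmean_sq hd hr A.toSIRGWeakAssumptions H h
  have h2 : Tendsto (fun n : ℕ => (K ^ 2 * volume.real (Metric.ball (0 : Euc d) (2 * r)) +
      (1 + 4 * K : ℝ) ^ 2) / n) atTop (𝓝 0) :=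
    tendsto_natCast_atTop_atTop.const_div_atTop _
  have h3 := h2.add h1
  rw [add_zero] at h3
  refine tendsto_of_tendsto_of_tendsto_of_le_of_le' tendsto_const_nhds h3
    (Eventually.of_forall fun n => variance_nonneg _ _) ?_
  filter_upwards [eventually_gt_atTop 0] with n hn
  exact var_n hd hn M hK H h _

end
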